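/- arXiv:1810.07603 — 9 statements merged into one kernel-verified Lean document; each statement's English description precedes it below -/
import Mathlib

section
/- Let a_1,…,a_n be positive integers, let l be an integer with 1 ≤ l ≤ n, and let A be a positive integer divisible by n. Consider the single channel with left capital c_L = 0 and right capital c_R = A(l+1), and the transaction value sequence of length N = n(l+2) given by v_i = a_i + A for 1 ≤ i ≤ n and v_i = −A/n for n < i ≤ n(l+2). Then there exists a feasible set S ⊆ {1,…,N} with |S| ≥ l + n(l+1) if and only if there exists a subset U' ⊆ {1,…,n} with |U'| = l and Σ_{i∈U'} a_i = A. -/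
/-- Feasibility of an accepted set `S` of transactions on a single channel with
left capital `cL` and right capital `cR`: every prefix partial sum of accepted
values stays within `[-cL, cR]`. -/
def SingleFeasible (N : ℕ) (v : Fin N → ℤ) (cL cR : ℤ) (S : Finset (Fin N)) : Prop :=
  ∀ j : Fin N,
    -cL ≤ ∑ i ∈ S.filter (fun i => i ≤ j), v i ∧
      ∑ i ∈ S.filter (fun i => i ≤ j), v i ≤ cR

/-- Splitting a sum over a finset of `Fin N` at the index `n ≤ N`. -/
theorem Fin.sum_eq_sum_castLE_add {M : Type*} [AddCommMonoid M] {n N : ℕ} (hn : n ≤ N)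
    (T : Finset (Fin N)) (f : Fin N → M) :
    ∑ i ∈ T, f i = ∑ i with Fin.castLE hn i ∈ T, f (Fin.castLE hn i)
      + ∑ i ∈ T.filter (fun i : Fin N => n ≤ (i : ℕ)), f i := by
  rw [← Finset.sum_filter_not_add_sum_filter T (fun i : Fin N => n ≤ (i : ℕ)) f]
  congr 1
  symm
  refine Finset.sum_bij (fun i _ => Fin.castLE hn i) ?_ ?_ ?_ ?_
  · intro i hi
    simpa using hi
  · intro i _ j _ h
    simpa using h
  · intro i hi
    simp only [Finset.mem_filter, not_le] at hi
    exact ⟨⟨i, hi.2⟩, by simpa using hi.1, rfl⟩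
  · intro i _
    rfl

theorem Fin.card_eq_card_castLE_add {n N : ℕ} (hn : n ≤ N) (T : Finset (Fin N)) :
    T.card = (Finset.univ.filter fun i : Fin n => Fin.castLE hn i ∈ T).card
      + (T.filter fun i : Fin N => n ≤ (i : ℕ)).card := by
  simp only [Finset.card_eq_sum_ones]
  exact Fin.sum_eq_sum_castLE_add hn T (fun _ => 1)

theorem Fin.card_filter_le_val_le {n N : ℕ} (hn : n ≤ N) (T : Finset (Fin N)) :
    n + (T.filter fun i : Fin N => n ≤ (i : ℕ)).card ≤ N := by
  have h := Fin.card_eq_card_castLE_add hn Finset.univ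
  have h' : (T.filter fun i : Fin N => n ≤ (i : ℕ)).card
      ≤ (Finset.univ.filter fun i : Fin N => n ≤ (i : ℕ)).card :=
    Finset.card_le_card (Finset.filter_subset_filter _ (Finset.subset_univ _))
  simp only [Finset.card_univ, Fintype.card_fin, Finset.mem_univ, Finset.filter_true] at h
  omega

/-- The total value of a set of transactions when the first `n` values are `b i`
and all later ones are `-c`. -/
theorem Fin.sum_dite_neg_const {n N : ℕ} (hn : n ≤ N) (b : Fin n → ℤ) (c : ℤ)
    (T : Finset (Fin N)) :
    ∑ i ∈ T, (if h : (i : ℕ) < n then b ⟨i, h⟩ else -c)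
      = ∑ i with Fin.castLE hn i ∈ T, b i - (T.filter fun i : Fin N => n ≤ (i : ℕ)).card * c := by
  rw [Fin.sum_eq_sum_castLE_add hn, sub_eq_add_neg]
  congr 1
  · exact Finset.sum_congr rfl fun i _ => by simp
  · rw [Finset.sum_congr rfl (g := fun _ => -c)]
    · simp
    · intro i hi
      rw [dif_neg (by simpa using (Finset.mem_filter.1 hi).2)]

/-- Reduction of Fixed Weight Subset Sum to the single-channel problem:
with left capital `0`, right capital `A(l+1)`, values `a_i + A` for the first `n`
transactions and `-A/n` for the remaining `n(l+1)` ones, a feasible set of size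
at least `l + n(l+1)` exists iff some `l`-element subset of the `a_i` sums to `A`. -/
theorem fwss_reduction (n l A : ℕ) (a : Fin n → ℕ)
    (ha : ∀ i, 0 < a i) (hl1 : 1 ≤ l) (hln : l ≤ n) (hA : 0 < A) (hdvd : n ∣ A) :
    (∃ S : Finset (Fin (n * (l + 2))),
        SingleFeasible (n * (l + 2))
          (fun i => if h : (i : ℕ) < n then (a ⟨i, h⟩ : ℤ) + (A : ℤ) else -((A / n : ℕ) : ℤ))
          0 ((A : ℤ) * ((l : ℤ) + 1)) S ∧
        l + n * (l + 1) ≤ S.card) ↔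
      (∃ U : Finset (Fin n), U.card = l ∧ ∑ i ∈ U, a i = A) := by
  have hnN : n ≤ n * (l + 2) := Nat.le_mul_of_pos_right _ (by omega)
  have hN : n * (l + 2) = n + n * (l + 1) := by ring
  have hc : (n : ℤ) * ((A / n : ℕ) : ℤ) = A := by exact_mod_cast Nat.mul_div_cancel' hdvd
  have hsum (V : Finset (Fin n)) :
      ∑ i ∈ V, ((a i : ℤ) + A) = ((∑ i ∈ V, a i : ℕ) : ℤ) + V.card * A := by
    simp [Finset.sum_add_distrib]
  constructor
  · rintro ⟨S, hS, hcard⟩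
    have hfirst := (hS ⟨n - 1, by omega⟩).2
    have hlast := (hS ⟨n * (l + 2) - 1, by omega⟩).1
    rw [Fin.sum_dite_neg_const hnN (fun i => (a i : ℤ) + A), hsum] at hfirst hlast
    have hall : S.filter (fun i => i ≤ ⟨n * (l + 2) - 1, by omega⟩) = S :=
      Finset.filter_true_of_mem fun i _ => by
        rw [Fin.le_def]
        have := i.isLt
        dsimp only
        omega
    rw [hall] at hlast
    have hnone : (S.filter (fun i => i ≤ ⟨n - 1, by omega⟩)).filter (fun i : Fin (n * (l + 2)) => n ≤ (i : ℕ))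
        = ∅ := by
      refine Finset.filter_false_of_mem fun i hi => ?_
      have := (Finset.mem_filter.1 hi).2
      rw [Fin.le_def] at this
      dsimp only at this
      omega
    have hpos : (Finset.univ.filter fun i : Fin n =>
        Fin.castLE hnN i ∈ S.filter (fun i => i ≤ ⟨n - 1, by omega⟩))
        = Finset.univ.filter fun i : Fin n => Fin.castLE hnN i ∈ S := by
      refine Finset.filter_congr fun i _ => ?_
      have := i.isLt
      simp only [Finset.mem_filter, Fin.le_def, Fin.val_castLE, and_iff_left_iff_imp]
      omega
    rw [hnone, hpos] at hfirst
    have hsplit := Fin.card_eq_card_castLE_add hnN S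
    have hle := Fin.card_filter_le_val_le hnN S
    generalize (S.filter fun i : Fin (n * (l + 2)) => n ≤ (i : ℕ)).card = q at *
    generalize hU : (Finset.univ.filter fun i : Fin n => Fin.castLE hnN i ∈ S) = U at *
    have hUl : l ≤ U.card := by omega
    have hUpos : 0 < ∑ i ∈ U, a i :=
      Finset.sum_pos (fun i _ => ha i) (Finset.card_pos.1 (by omega))
    simp only [Finset.card_empty, Nat.cast_zero, zero_mul, sub_zero] at hfirst
    have hUeq : U.card = l := by
      by_contra hne
      have h1 : (l : ℤ) + 1 ≤ U.card := by exact_mod_cast (by omega : l + 1 ≤ U.card)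
      have h2 : (A : ℤ) * (l + 1) ≤ A * U.card := mul_le_mul_of_nonneg_left h1 (by positivity)
      have h3 : (0 : ℤ) < (∑ i ∈ U, a i : ℕ) := by exact_mod_cast hUpos
      linarith
    have hq : q = n * (l + 1) := by omega
    refine ⟨U, hUeq, ?_⟩
    rw [hUeq] at hfirst hlast
    have hqc : (q : ℤ) * ((A / n : ℕ) : ℤ) = A * (l + 1) := by
      rw [hq, ← hc]
      push_cast
      ring
    rw [hqc] at hlast
    zify
    push_cast at hfirst hlast
    linarith
  · rintro ⟨U, hUl, hUA⟩
    let S : Finset (Fin (n * (l + 2))) :=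
      Finset.univ.filter fun i => ∀ h : (i : ℕ) < n, (⟨i, h⟩ : Fin n) ∈ U
    have hSU : (Finset.univ.filter fun i : Fin n => Fin.castLE hnN i ∈ S) = U := by
      ext i
      simp [S]
    refine ⟨S, fun j => ?_, ?_⟩
    · rw [Fin.sum_dite_neg_const hnN (fun i => (a i : ℤ) + A)]
      have hq := Fin.card_filter_le_val_le hnN (S.filter fun i => i ≤ j)
      have hsub : (Finset.univ.filter fun i : Fin n =>
          Fin.castLE hnN i ∈ S.filter fun i => i ≤ j) ⊆ U := by
        rw [← hSU]
        exact Finset.monotone_filter_right _ fun i _ hi => (Finset.mem_filter.1 hi).1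
      have hU : ∑ i ∈ U, ((a i : ℤ) + A) = A * (l + 1) := by
        rw [hsum, hUA, hUl]
        ring
      constructor
      · rcases lt_or_ge (j : ℕ) n with hj | hj
        · have hnone : (S.filter (fun i => i ≤ j)).filter (fun i : Fin (n * (l + 2)) => n ≤ (i : ℕ)) = ∅ := by
            refine Finset.filter_false_of_mem fun i hi => ?_
            have := (Finset.mem_filter.1 hi).2
            rw [Fin.le_def] at this
            omega
          rw [hnone]
          simp only [Finset.card_empty, Nat.cast_zero, zero_mul, sub_zero, neg_zero]
          exact Finset.sum_nonneg fun i _ => by positivity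
        · have hpos : (Finset.univ.filter fun i : Fin n =>
              Fin.castLE hnN i ∈ S.filter fun i => i ≤ j) = U := by
            rw [← hSU]
            refine Finset.filter_congr fun i _ => ?_
            have := i.isLt
            simp only [Finset.mem_filter, Fin.le_def, Fin.val_castLE, and_iff_left_iff_imp]
            omega
          rw [hpos, hU]
          generalize ((S.filter (fun i => i ≤ j)).filter (fun i : Fin (n * (l + 2)) => n ≤ (i : ℕ))).card = q at *
          have hq' : (q : ℤ) ≤ n * (l + 1) := by exact_mod_cast (by omega : q ≤ n * (l + 1))
          have := mul_le_mul_of_nonneg_right hq' (Int.natCast_nonneg (A / n))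
          rw [mul_right_comm, hc] at this
          linarith
      · have h1 := Finset.sum_le_sum_of_subset_of_nonneg hsub
          (f := fun i => (a i : ℤ) + A) fun i _ _ => by positivity
        rw [hU] at h1
        exact (sub_le_self _ (by positivity)).trans h1
    · rw [Fin.card_eq_card_castLE_add hnN S, hSU, hUl]
      have h := Fin.card_eq_card_castLE_add hnN Finset.univ
      simp only [Finset.card_univ, Fintype.card_fin, Finset.mem_univ, Finset.filter_true] at h
      have hS : S.filter (fun i : Fin (n * (l + 2)) => n ≤ (i : ℕ))
          = Finset.univ.filter fun i : Fin (n * (l + 2)) => n ≤ (i : ℕ) := by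
        ext i
        simp only [S, Finset.mem_filter, Finset.mem_univ, true_and, and_iff_right_iff_imp]
        intro hi h
        omega
      rw [hS]
      omega
end

section
/- Suppose a sequence of transactions t_1,…,t_n (each t_i = (s_i, r_i, v_i) with positive integer value v_i) can be executed by a feasible routing in some payment network N on finite vertex set V with total locked capital C. Then for every vertex m ∈ V there exist capitals on the star graph with center m and leaf set V∖{m} such that all of t_1,…,t_n can be executed in this star (each transaction t_i routed along the unique path s_i–m–r_i, or directly if s_i = m or r_i = m) with total locked capital at most 2C. -/
/-- A transaction: sender, receiver, and (integer) value. -/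
structure Txn (V : Type*) where
  src : V
  dst : V
  val : ℤ

variable {V : Type*}

/-- Moving `val` units of capital across the channel `{u, v}` in direction `u → v`:
the capital on `u`'s side decreases by `val` and the capital on `v`'s side
increases by `val`. -/
def step [DecidableEq V] (val : ℤ) (u v : V) (c : V → V → ℤ) : V → V → ℤ :=
  fun x y =>
    if x = u ∧ y = v then c x y - val
    else if x = v ∧ y = u then c x y + val
    else c x y

/-- Executing a transaction of value `val` along a path (given as a list of vertices). -/
def execPath [DecidableEq V] (val : ℤ) : List V → (V → V → ℤ) → (V → V → ℤ)
  | u :: v :: rest, c => execPath val (v :: rest) (step val u v c)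
  | _, c => c

/-- `p` is a (simple) path from `a` to `b` using only edges of `E`. -/
def IsPathOn (E : Finset (Sym2 V)) (p : List V) (a b : V) : Prop :=
  p.head? = some a ∧ p.getLast? = some b ∧ p.Nodup ∧ p.Chain' (fun u v => s(u, v) ∈ E)

/-- Processing a list of transactions in order, each together with an optional routing
path (`none` means the transaction is skipped, `some p` means it is executed along the
path `p`); every side capital must remain nonnegative at all times. -/
def Feasible [DecidableEq V] (E : Finset (Sym2 V)) :
    (V → V → ℤ) → List (Txn V × Option (List V)) → Prop
  | _, [] => True
  | c, (_, none) :: rest => Feasible E c rest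
  | c, (t, some p) :: rest =>
      IsPathOn E p t.src t.dst ∧ (∀ x y, 0 ≤ execPath t.val p c x y) ∧
        Feasible E (execPath t.val p c) rest

/-- The total locked capital: the sum of the capitals on both sides of all channels. -/
def totalCap [Fintype V] (c : V → V → ℤ) : ℤ := ∑ x, ∑ y, c x y

/-- The edge set of the star with center `m` and leaf set `V \ {m}`. -/
def starEdges [Fintype V] [DecidableEq V] (m : V) : Finset (Sym2 V) :=
  (Finset.univ.filter (· ≠ m)).image (fun x => s(m, x))

/-- The routing of a transaction in the star with center `m`: along the unique path
`src – m – dst`, or directly if `m` is its sender or receiver. -/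
def starPath [DecidableEq V] (m : V) (t : Txn V) : List V :=
  if t.src = m ∨ t.dst = m then [t.src, t.dst] else [t.src, m, t.dst]

/-- The capital held by `x` on its own sides of its channels. -/
def outCap [Fintype V] (c : V → V → ℤ) (x : V) : ℤ := ∑ y, c x y

/-- The capital held by the partners of `x` on the other sides of its channels. -/
def inCap [Fintype V] (c : V → V → ℤ) (x : V) : ℤ := ∑ y, c y x

/-- The star capitals in which every leaf merges all its channels into the one to the center. -/
def starCap [Fintype V] [DecidableEq V] (m : V) (c : V → V → ℤ) : V → V → ℤ :=
  fun x y =>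
    if x ≠ m ∧ y = m then outCap c x
    else if x = m ∧ y ≠ m then inCap c y
    else 0

theorem outCap_step [Fintype V] [DecidableEq V] (val : ℤ) {u v : V} (huv : u ≠ v)
    (c : V → V → ℤ) (x : V) :
    outCap (step val u v c) x
      = outCap c x - (if x = u then val else 0) + (if x = v then val else 0) := by
  have h : ∀ y, step val u v c x y = c x y - (if y = v then (if x = u then val else 0) else 0)
      + (if y = u then (if x = v then val else 0) else 0) := by
    intro y
    unfold step
    split_ifs <;> simp_all
  simp only [outCap, h, Finset.sum_add_distrib, Finset.sum_sub_distrib, Finset.sum_ite_eq',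
    Finset.mem_univ, if_true]

theorem inCap_step [Fintype V] [DecidableEq V] (val : ℤ) {u v : V} (huv : u ≠ v)
    (c : V → V → ℤ) (x : V) :
    inCap (step val u v c) x
      = inCap c x + (if x = u then val else 0) - (if x = v then val else 0) := by
  have h : ∀ y, step val u v c y x = c y x + (if y = v then (if x = u then val else 0) else 0)
      - (if y = u then (if x = v then val else 0) else 0) := by
    intro y
    unfold step
    split_ifs <;> simp_all
  simp only [inCap, h, Finset.sum_add_distrib, Finset.sum_sub_distrib, Finset.sum_ite_eq',
    Finset.mem_univ, if_true]

/-- Executing a simple path changes the capital of its end points only. -/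
theorem outCap_inCap_execPath [Fintype V] [DecidableEq V] (val : ℤ) (b : V) (p : List V) :
    ∀ (a : V) (c : V → V → ℤ), p.head? = some a → p.getLast? = some b → p.Nodup → ∀ x,
      outCap (execPath val p c) x
          = outCap c x - (if x = a then val else 0) + (if x = b then val else 0) ∧
        inCap (execPath val p c) x
          = inCap c x + (if x = a then val else 0) - (if x = b then val else 0) := by
  induction p with
  | nil => intro a c h; simp at h
  | cons u rest ih =>
    intro a c ha hb hnd x
    obtain rfl : u = a := by simpa using ha
    cases rest with
    | nil =>
      obtain rfl : u = b := by simpa using hb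
      simp [execPath]
    | cons v rest =>
      have huv : u ≠ v := by
        rintro rfl
        simp at hnd
      have key := ih v (step val u v c) rfl (by simpa using hb) (List.nodup_cons.1 hnd).2 x
      rw [outCap_step val huv, inCap_step val huv] at key
      simp only [execPath]
      constructor
      · linarith [key.1]
      · linarith [key.2]

theorem starCap_nonneg [Fintype V] [DecidableEq V] (m : V) {c : V → V → ℤ}
    (hc : ∀ x y, 0 ≤ c x y) (x y : V) : 0 ≤ starCap m c x y := by
  unfold starCap
  split_ifs
  · exact Finset.sum_nonneg fun _ _ => hc _ _
  · exact Finset.sum_nonneg fun _ _ => hc _ _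
  · exact le_rfl

theorem mem_starEdges [Fintype V] [DecidableEq V] {m x y : V} :
    s(x, y) ∈ starEdges m ↔ (x ≠ m ∧ y = m) ∨ (x = m ∧ y ≠ m) := by
  simp only [starEdges, Finset.mem_image, Finset.mem_filter, Finset.mem_univ, true_and,
    Sym2.eq_iff]
  constructor
  · rintro ⟨z, hz, ⟨rfl, rfl⟩ | ⟨rfl, rfl⟩⟩
    · exact Or.inr ⟨rfl, hz⟩
    · exact Or.inl ⟨hz, rfl⟩
  · rintro (⟨hx, rfl⟩ | ⟨rfl, hy⟩)
    · exact ⟨x, hx, Or.inr ⟨rfl, rfl⟩⟩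
    · exact ⟨y, hy, Or.inl ⟨rfl, rfl⟩⟩

theorem isPathOn_starPath [Fintype V] [DecidableEq V] (m : V) {t : Txn V} (ht : t.src ≠ t.dst) :
    IsPathOn (starEdges m) (starPath m t) t.src t.dst := by
  unfold starPath IsPathOn
  split_ifs with h
  · refine ⟨rfl, rfl, by simpa using ht, ?_⟩
    refine List.isChain_pair.2 (mem_starEdges.2 ?_)
    rcases h with h | h
    · exact Or.inr ⟨h, fun h' => ht (h.trans h'.symm)⟩
    · exact Or.inl ⟨fun h' => ht (h'.trans h.symm), h⟩
  · push Not at h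
    refine ⟨rfl, rfl, by simp [h.1, ht, h.2.symm], ?_⟩
    exact List.isChain_cons_cons.2 ⟨mem_starEdges.2 (Or.inl ⟨h.1, rfl⟩),
      List.isChain_pair.2 (mem_starEdges.2 (Or.inr ⟨rfl, h.2⟩))⟩

/-- Merging channels into a star commutes with executing a transaction. -/
theorem starCap_execPath [Fintype V] [DecidableEq V] (m : V) {E : Finset (Sym2 V)} {t : Txn V}
    (ht : t.src ≠ t.dst) {p : List V} (hp : IsPathOn E p t.src t.dst) (c : V → V → ℤ) :
    execPath t.val (starPath m t) (starCap m c) = starCap m (execPath t.val p c) := by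
  obtain ⟨ha, hb, hnd, -⟩ := hp
  have key := outCap_inCap_execPath t.val t.dst p t.src c ha hb hnd
  funext x y
  simp only [starCap, (key _).1, (key _).2, starPath]
  clear key ha hb hnd
  generalize t.src = a, t.dst = b at *
  split_ifs with h <;> simp only [execPath, step, starCap] <;> grind

theorem totalCap_starCap_le [Fintype V] [DecidableEq V] (m : V) {c : V → V → ℤ}
    (hc : ∀ x y, 0 ≤ c x y) : totalCap (starCap m c) ≤ 2 * totalCap c := by
  have hout : ∀ x, 0 ≤ outCap c x := fun x => Finset.sum_nonneg fun _ _ => hc _ _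
  have hin : ∀ x, 0 ≤ inCap c x := fun x => Finset.sum_nonneg fun _ _ => hc _ _
  have hle : ∀ x y, starCap m c x y
      ≤ (if y = m then outCap c x else 0) + (if x = m then inCap c y else 0) := by
    intro x y
    have := hout x
    have := hin y
    unfold starCap
    split_ifs <;> first | omega | simp_all
  calc totalCap (starCap m c)
      ≤ ∑ x, ∑ y, ((if y = m then outCap c x else 0) + (if x = m then inCap c y else 0)) :=
        Finset.sum_le_sum fun x _ => Finset.sum_le_sum fun y _ => hle x y
    _ = ∑ x, outCap c x + ∑ y, inCap c y := by
        simp only [Finset.sum_add_distrib, Finset.sum_ite_eq', Finset.mem_univ, if_true]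
        congr 1
        rw [Finset.sum_comm]
        simp
    _ = 2 * totalCap c := by
        have : ∑ y, inCap c y = totalCap c := Finset.sum_comm
        rw [this, two_mul]
        rfl

/-- A feasible routing in any network induces one through the center of the merged star. -/
theorem feasible_starCap [Fintype V] [DecidableEq V] {ι : Type*} (m : V) (E : Finset (Sym2 V))
    (txns : ι → Txn V) (hsr : ∀ i, (txns i).src ≠ (txns i).dst) (R : ι → List V) (l : List ι) :
    ∀ c : V → V → ℤ, Feasible E c (l.map fun i => (txns i, some (R i))) →
      Feasible (starEdges m) (starCap m c)
        (l.map fun i => (txns i, some (starPath m (txns i)))) := by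
  induction l with
  | nil => intro c _; trivial
  | cons i l ih =>
    rintro c ⟨hp, hpos, hrest⟩
    have hexec := starCap_execPath m (hsr i) hp c
    refine ⟨isPathOn_starPath m (hsr i), ?_, ?_⟩
    · rw [hexec]
      exact starCap_nonneg m hpos
    · rw [hexec]
      exact ih _ hrest

/-- If a payment network on `V` executes the transactions `t_1, …, t_n` by a feasible
routing with total locked capital `C`, then for every center `m ∈ V` there are
capitals on the star with center `m` executing all the transactions (each via the
center) with total locked capital at most `2C`. -/
theorem star_two_approximation {V : Type*} [Fintype V] [DecidableEq V]
    (E : Finset (Sym2 V)) (cap : V → V → ℤ)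
    (hnonneg : ∀ x y, 0 ≤ cap x y)
    (hsupp : ∀ x y, s(x, y) ∉ E → cap x y = 0)
    (n : ℕ) (txns : Fin n → Txn V)
    (hval : ∀ i, 0 < (txns i).val)
    (hsr : ∀ i, (txns i).src ≠ (txns i).dst)
    (R : Fin n → List V)
    (hfeas : Feasible E cap ((List.finRange n).map (fun i => (txns i, some (R i)))))
    (C : ℤ) (hC : totalCap cap = C) (m : V) :
    ∃ cap' : V → V → ℤ,
      (∀ x y, 0 ≤ cap' x y) ∧
      (∀ x y, s(x, y) ∉ starEdges m → cap' x y = 0) ∧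
      Feasible (starEdges m) cap'
        ((List.finRange n).map (fun i => (txns i, some (starPath m (txns i))))) ∧
      totalCap cap' ≤ 2 * C := by
  refine ⟨starCap m cap, starCap_nonneg m hnonneg, fun x y hxy => ?_,
    feasible_starCap m E txns hsr R _ cap hfeas, hC ▸ totalCap_starCap_le m hnonneg⟩
  rw [mem_starEdges, not_or] at hxy
  simp only [starCap, if_neg hxy.1, if_neg hxy.2]
end

section
/- Fix a per-transaction fee f ∈ (0,1) and a transaction sequence t_1,…,t_n. If a finite simple graph G (on the set of vertices involved in the transactions) contains a cycle, then there exists a graph G' on the same vertex set with strictly fewer edges in which every transaction executable in G is still executable; consequently profit(G') > profit(G), and a profit-maximizing graph in the unlimited-capital model contains no cycles. -/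
/-- In the unlimited-capital profit model (profit of `G` is
`f · #{executable transactions} − #edges`, a transaction being executable iff its
endpoints are in the same connected component), any graph containing a cycle can be
replaced by a graph with strictly fewer edges preserving executability, hence with
strictly larger profit; consequently a profit-maximizing graph is acyclic. -/
theorem profit_maximizer_acyclic (V : Type*) [Fintype V]
    (n : ℕ) (src dst : Fin n → V) (f : ℝ) (hf0 : 0 < f) (hf1 : f < 1) :
    (∀ G : SimpleGraph V, ¬ G.IsAcyclic →
      ∃ G' : SimpleGraph V,
        Nat.card G'.edgeSet < Nat.card G.edgeSet ∧
        (∀ i : Fin n, G.Reachable (src i) (dst i) → G'.Reachable (src i) (dst i)) ∧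
        f * (Nat.card {i : Fin n // G.Reachable (src i) (dst i)} : ℝ) -
            (Nat.card G.edgeSet : ℝ) <
          f * (Nat.card {i : Fin n // G'.Reachable (src i) (dst i)} : ℝ) -
            (Nat.card G'.edgeSet : ℝ)) ∧
    (∀ G : SimpleGraph V,
      (∀ H : SimpleGraph V,
        f * (Nat.card {i : Fin n // H.Reachable (src i) (dst i)} : ℝ) -
            (Nat.card H.edgeSet : ℝ) ≤
          f * (Nat.card {i : Fin n // G.Reachable (src i) (dst i)} : ℝ) -
            (Nat.card G.edgeSet : ℝ)) →
      G.IsAcyclic) := by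
  have key : ∀ G : SimpleGraph V, ¬ G.IsAcyclic →
      ∃ G' : SimpleGraph V,
        Nat.card G'.edgeSet < Nat.card G.edgeSet ∧
        (∀ i : Fin n, G.Reachable (src i) (dst i) → G'.Reachable (src i) (dst i)) ∧
        f * (Nat.card {i : Fin n // G.Reachable (src i) (dst i)} : ℝ) -
            (Nat.card G.edgeSet : ℝ) <
          f * (Nat.card {i : Fin n // G'.Reachable (src i) (dst i)} : ℝ) -
            (Nat.card G'.edgeSet : ℝ) := by
    intro G hG
    obtain ⟨F, hFG, hF, hreach⟩ := G.exists_isAcyclic_reachable_eq_le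
    have hssub : F < G := lt_of_le_of_ne hFG fun h => hG (h ▸ hF)
    have hlt : Nat.card F.edgeSet < Nat.card G.edgeSet :=
      Set.ncard_lt_ncard (SimpleGraph.edgeSet_ssubset_edgeSet.mpr hssub) (Set.toFinite _)
    refine ⟨F, hlt, fun i hi => hreach ▸ hi, ?_⟩
    rw [hreach]
    exact sub_lt_sub_left (Nat.cast_lt.mpr hlt) _
  refine ⟨key, fun G hmax => ?_⟩
  by_contra hG
  obtain ⟨H, -, -, hH⟩ := key G hG
  exact (hmax H).not_gt hH
end

section
/- Let 0 < ε < 1 and fee f = 1 − ε, and consider the five unit-value transactions t_1=(v_1,v_2,1), t_2=(v_1,v_2,1), t_3=(v_3,v_4,1), t_4=(v_3,v_4,1), t_5=(v_1,v_3,1) on the vertex set {v_1,v_2,v_3,v_4}. The disconnected graph with edge set {{v_1,v_2},{v_3,v_4}} has profit 4(1−ε) − 2 = 2 − 4ε, and every connected simple graph on {v_1,v_2,v_3,v_4} has profit at most 5(1−ε) − 3 = 2 − 5ε < 2 − 4ε. Hence the optimal network for maximum profit is not necessarily connected. -/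
/-- The senders of the five unit transactions
`(v₁,v₂), (v₁,v₂), (v₃,v₄), (v₃,v₄), (v₁,v₃)` (vertices `0, 1, 2, 3`). -/
def txSrc3 : Fin 5 → Fin 4 := ![0, 0, 2, 2, 0]

/-- The receivers of the five unit transactions. -/
def txDst3 : Fin 5 → Fin 4 := ![1, 1, 3, 3, 2]

/-- Profit of a graph `G` under fee `f`: `f · #{executable transactions} − #edges`,
where a transaction is executable iff sender and receiver are in the same
connected component. -/
noncomputable def profit3 (f : ℝ) (G : SimpleGraph (Fin 4)) : ℝ :=
  f * (Nat.card {i : Fin 5 // G.Reachable (txSrc3 i) (txDst3 i)} : ℝ) -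
    (Nat.card G.edgeSet : ℝ)

/-- A function constant along edges is constant on connected components. -/
lemma SimpleGraph.Reachable.apply_eq {V α : Type*} {G : SimpleGraph V} {c : V → α}
    (hc : ∀ u v, G.Adj u v → c u = c v) {u v : V} (h : G.Reachable u v) : c u = c v := by
  obtain ⟨p⟩ := h
  induction p with
  | nil => rfl
  | cons hadj _ ih => exact (hc _ _ hadj).trans ih

/-- In the graph with edges `{v₁,v₂}, {v₃,v₄}` exactly the first four transactions are
executable. -/
lemma reachable_txSrc3_txDst3_iff (i : Fin 5) :
    (SimpleGraph.fromEdgeSet ({s(0, 1), s(2, 3)} : Set (Sym2 (Fin 4)))).Reachable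
      (txSrc3 i) (txDst3 i) ↔ i ≠ 4 := by
  constructor
  · rintro h rfl
    have hc := h.apply_eq (c := fun v : Fin 4 => decide (v < 2)) (by
      simp only [SimpleGraph.fromEdgeSet_adj, Set.mem_insert_iff, Set.mem_singleton_iff]
      decide)
    simp [txSrc3, txDst3] at hc
  · intro hi
    apply SimpleGraph.Adj.reachable
    simp only [SimpleGraph.fromEdgeSet_adj, Set.mem_insert_iff, Set.mem_singleton_iff]
    revert i
    decide

lemma card_edgeSet_fromEdgeSet_matching :
    Nat.card (SimpleGraph.fromEdgeSet ({s(0, 1), s(2, 3)} : Set (Sym2 (Fin 4)))).edgeSet = 2 := by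
  have h : (SimpleGraph.fromEdgeSet ({s(0, 1), s(2, 3)} : Set (Sym2 (Fin 4)))).edgeSet =
      {s(0, 1), s(2, 3)} := by
    rw [SimpleGraph.edgeSet_fromEdgeSet, sdiff_eq_left, Set.disjoint_left]
    rintro e (rfl | rfl) <;> simp
  rw [h, Nat.card_coe_set_eq, Set.ncard_pair (by decide)]

/-- For the five transactions above and fee `1 − ε` with `0 < ε < 1`, the
disconnected graph with edges `{v₁,v₂}, {v₃,v₄}` has profit `2 − 4ε`, while every
connected graph has profit at most `2 − 5ε < 2 − 4ε`. Hence the optimal network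
for maximum profit is not necessarily connected. -/
theorem optimal_not_connected (ε : ℝ) (hε0 : 0 < ε) (hε1 : ε < 1) :
    profit3 (1 - ε) (SimpleGraph.fromEdgeSet ({s(0, 1), s(2, 3)} : Set (Sym2 (Fin 4)))) =
        2 - 4 * ε ∧
    (∀ G : SimpleGraph (Fin 4), G.Connected → profit3 (1 - ε) G ≤ 2 - 5 * ε) ∧
    2 - 5 * ε < 2 - 4 * ε := by
  refine ⟨?_, fun G hG => ?_, by linarith⟩
  · have hcard : Nat.card {i : Fin 5 // i ≠ 4} = 4 := by
      rw [Nat.card_eq_fintype_card]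
      decide
    simp only [profit3, reachable_txSrc3_txDst3_iff, card_edgeSet_fromEdgeSet_matching, hcard]
    push_cast
    ring
  · have hedges : (3 : ℝ) ≤ Nat.card G.edgeSet := by
      have h := hG.card_vert_le_card_edgeSet_add_one
      rw [Nat.card_eq_fintype_card, Fintype.card_fin] at h
      exact_mod_cast (by omega : 3 ≤ Nat.card G.edgeSet)
    have hexec : (Nat.card {i : Fin 5 // G.Reachable (txSrc3 i) (txDst3 i)} : ℝ) ≤ 5 := by
      have h := Finite.card_subtype_le fun i : Fin 5 => G.Reachable (txSrc3 i) (txDst3 i)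
      rw [Nat.card_eq_fintype_card (α := Fin 5), Fintype.card_fin] at h
      exact_mod_cast h
    have hmul := mul_le_mul_of_nonneg_left hexec (sub_nonneg.mpr hε1.le)
    rw [profit3]
    linarith
end

section
/- Let a > 11 be an integer and consider the sequence of 6a unit-value transactions consisting, in this order, of a copies of (v_2,v_1,1), then a copies of (v_2,v_3,1), then a copies of (v_4,v_3,1), then a copies of (v_4,v_5,1), then a copies of (v_6,v_5,1), then a copies of (v_6,v_1,1). Every acyclic network on the vertex set {v_1,…,v_6} that admits a feasible routing executing at least 6a − 1 of these transactions has total locked capital at least 7a − 5, which is strictly greater than 6a + 6. Hence (together with the feasibility of the cycle network with total capital 6a and 6 edges, i.e., total cost 6a + 6) the optimal graph under capital budget C = 6a + 6 is not a tree or forest. -/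
variable {V : Type*}

/-- The sequence of `6a` unit transactions: `a` copies each of
`(v₂,v₁), (v₂,v₃), (v₄,v₃), (v₄,v₅), (v₆,v₅), (v₆,v₁)` (vertices `0, …, 5`). -/
def cycleTxList (a : ℕ) : List (Txn (Fin 6)) :=
  List.replicate a ⟨1, 0, 1⟩ ++ List.replicate a ⟨1, 2, 1⟩ ++ List.replicate a ⟨3, 2, 1⟩ ++
    List.replicate a ⟨3, 4, 1⟩ ++ List.replicate a ⟨5, 4, 1⟩ ++ List.replicate a ⟨5, 0, 1⟩

/-- The capital locked on the `S`-side of the channels leaving `S`. -/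
def cutCap [Fintype V] [DecidableEq V] (S : Finset V) (c : V → V → ℤ) : ℤ :=
  ∑ x ∈ S, ∑ y ∈ Sᶜ, c x y

/-- The integer-valued indicator of `S`. -/
def side [DecidableEq V] (S : Finset V) (x : V) : ℤ := if x ∈ S then 1 else 0

lemma cutCap_nonneg [Fintype V] [DecidableEq V] (S : Finset V) {c : V → V → ℤ}
    (hc : ∀ x y, 0 ≤ c x y) : 0 ≤ cutCap S c :=
  Finset.sum_nonneg fun x _ => Finset.sum_nonneg fun y _ => hc x y

lemma cutCap_step [Fintype V] [DecidableEq V] (S : Finset V) (val : ℤ) (u v : V)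
    (c : V → V → ℤ) :
    cutCap S (step val u v c) = cutCap S c - val * (side S u - side S v) := by
  have h : ∀ x ∈ S, ∀ y ∈ Sᶜ, step val u v c x y =
      c x y - (if x = u then (if y = v then val else 0) else 0)
        + (if x = v then (if y = u then val else 0) else 0) := by
    intro x hx y hy
    have hxy : x ≠ y := by rintro rfl; simp [hx] at hy
    unfold step
    by_cases h1 : x = u <;> by_cases h2 : y = v <;> by_cases h3 : x = v <;>
      by_cases h4 : y = u <;> simp_all
  unfold cutCap
  rw [Finset.sum_congr rfl fun x hx => Finset.sum_congr rfl fun y hy => h x hx y hy]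
  simp only [Finset.sum_add_distrib, Finset.sum_sub_distrib, Finset.sum_ite_irrel,
    Finset.sum_const_zero, Finset.sum_ite_eq', Finset.mem_compl, side]
  by_cases hu : u ∈ S <;> by_cases hv : v ∈ S <;> simp [hu, hv]

lemma cutCap_execPath [Fintype V] [DecidableEq V] (S : Finset V) (val : ℤ) (p : List V)
    (a b : V) (c : V → V → ℤ) (ha : p.head? = some a) (hb : p.getLast? = some b) :
    cutCap S (execPath val p c) = cutCap S c - val * (side S a - side S b) := by
  induction p generalizing a c with
  | nil => simp at ha
  | cons u q ih =>
    obtain rfl : u = a := by simpa using ha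
    cases q with
    | nil =>
      obtain rfl : u = b := by simpa using hb
      simp [execPath]
    | cons v r =>
      rw [execPath, ih v _ rfl (by simpa using hb), cutCap_step]
      ring

/-- Processing `n` copies of one unit transaction changes every cut by the executed amount. -/
lemma feasible_replicate_append [Fintype V] [DecidableEq V] (E : Finset (Sym2 V))
    (s r : V) (L : List (Txn V)) (n : ℕ) (c : V → V → ℤ) (P : List (Option (List V)))
    (hc : ∀ x y, 0 ≤ c x y) (hlen : P.length = n + L.length)
    (hfeas : Feasible E c ((List.replicate n (Txn.mk s r 1) ++ L).zip P)) :
    ∃ (c' : V → V → ℤ) (k : ℕ) (P' : List (Option (List V))), (∀ x y, 0 ≤ c' x y) ∧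
      Feasible E c' (L.zip P') ∧ P'.length = L.length ∧ k ≤ n ∧
      P.countP (fun o => o.isSome) = k + P'.countP (fun o => o.isSome) ∧
      ∀ S, cutCap S c' = cutCap S c - k * (side S s - side S r) := by
  induction n generalizing c P with
  | zero =>
    exact ⟨c, 0, P, hc, by simpa using hfeas, by simpa using hlen, le_rfl, by simp, by simp⟩
  | succ n ih =>
    cases P with
    | nil => simp at hlen; omega
    | cons o P =>
      have hl : P.length = n + L.length := by simp at hlen; omega
      rw [List.replicate_succ, List.cons_append, List.zip_cons_cons] at hfeas
      cases o with
      | none =>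
        obtain ⟨c', k, P', h1, h2, h3, h4, h5, h6⟩ := ih c P hc hl hfeas
        exact ⟨c', k, P', h1, h2, h3, by omega, by simpa using h5, h6⟩
      | some p =>
        obtain ⟨hp, hnn, hf⟩ := hfeas
        obtain ⟨c', k, P', h1, h2, h3, h4, h5, h6⟩ := ih _ P hnn hl hf
        refine ⟨c', k + 1, P', h1, h2, h3, by omega, ?_, fun S => ?_⟩
        · simp only [List.countP_cons, h5, Option.isSome_some, if_true]; omega
        · rw [h6, cutCap_execPath S 1 p s r c hp.1 hp.2.1]
          push_cast; ring

/-- Any proper cut must lock at least `a - 1` units of capital, and a cut around a single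
vertex at least `2a - 1`. -/
lemma cut_lower_bounds (a : ℕ) (E : Finset (Sym2 (Fin 6))) (cap : Fin 6 → Fin 6 → ℤ)
    (hnonneg : ∀ x y, 0 ≤ cap x y)
    (P : List (Option (List (Fin 6)))) (hlen : P.length = (cycleTxList a).length)
    (hfeas : Feasible E cap ((cycleTxList a).zip P))
    (hcount : 6 * a - 1 ≤ P.countP (fun o => o.isSome)) :
    (∀ S : Finset (Fin 6), S ≠ ∅ → S ≠ Finset.univ →
      (a : ℤ) - 1 ≤ cutCap S cap + cutCap Sᶜ cap) ∧
    ∀ v : Fin 6, 2 * (a : ℤ) - 1 ≤ cutCap {v} cap + cutCap {v}ᶜ cap := by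
  have hT : cycleTxList a = List.replicate a ⟨1, 0, 1⟩ ++ (List.replicate a ⟨1, 2, 1⟩ ++
      (List.replicate a ⟨3, 2, 1⟩ ++ (List.replicate a ⟨3, 4, 1⟩ ++
      (List.replicate a ⟨5, 4, 1⟩ ++ (List.replicate a ⟨5, 0, 1⟩ ++ []))))) := by
    simp [cycleTxList]
  rw [hT] at hlen hfeas
  obtain ⟨c1, k1, P1, n1, f1, l1, b1, q1, x1⟩ :=
    feasible_replicate_append E _ _ _ a cap P hnonneg (by simpa using hlen) hfeas
  obtain ⟨c2, k2, P2, n2, f2, l2, b2, q2, x2⟩ :=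
    feasible_replicate_append E _ _ _ a c1 P1 n1 (by simpa using l1) f1
  obtain ⟨c3, k3, P3, n3, f3, l3, b3, q3, x3⟩ :=
    feasible_replicate_append E _ _ _ a c2 P2 n2 (by simpa using l2) f2
  obtain ⟨c4, k4, P4, n4, f4, l4, b4, q4, x4⟩ :=
    feasible_replicate_append E _ _ _ a c3 P3 n3 (by simpa using l3) f3
  obtain ⟨c5, k5, P5, n5, f5, l5, b5, q5, x5⟩ :=
    feasible_replicate_append E _ _ _ a c4 P4 n4 (by simpa using l4) f4
  obtain ⟨c6, k6, P6, n6, f6, l6, b6, q6, x6⟩ :=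
    feasible_replicate_append E _ _ _ a c5 P5 n5 (by simpa using l5) f5
  obtain rfl : P6 = [] := by simpa using l6
  have hk : 6 * a - 1 ≤ k1 + k2 + k3 + k4 + k5 + k6 := by simp at q6; omega
  clear hT hlen hfeas f1 f2 f3 f4 f5 f6 l1 l2 l3 l4 l5 l6 q1 q2 q3 q4 q5 q6 hcount
  have hside : ∀ (S : Finset (Fin 6)) x, side Sᶜ x = 1 - side S x := by
    intro S x; by_cases h : x ∈ S <;> simp [side, h]
  have main : ∀ S : Finset (Fin 6),
      ∀ i : ℤ, (i = k1 * (side S 1 - side S 0) ∨ i = k2 * (side S 1 - side S 2) ∨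
        i = k3 * (side S 3 - side S 2) ∨ i = k4 * (side S 3 - side S 4) ∨
        i = k5 * (side S 5 - side S 4) ∨
        i = k1 * (side S 1 - side S 0) + k2 * (side S 1 - side S 2) +
          k3 * (side S 3 - side S 2) + k4 * (side S 3 - side S 4) +
          k5 * (side S 5 - side S 4) + k6 * (side S 5 - side S 0)) →
        |i| ≤ cutCap S cap + cutCap Sᶜ cap := by
    intro S i hi
    have y1 := x1 Sᶜ; have y2 := x2 Sᶜ; have y3 := x3 Sᶜ
    have y4 := x4 Sᶜ; have y5 := x5 Sᶜ; have y6 := x6 Sᶜ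
    simp only [hside] at y1 y2 y3 y4 y5 y6
    have p0 := cutCap_nonneg S hnonneg; have r0 := cutCap_nonneg Sᶜ hnonneg
    have p1 := cutCap_nonneg S n1; have r1 := cutCap_nonneg Sᶜ n1
    have p2 := cutCap_nonneg S n2; have r2 := cutCap_nonneg Sᶜ n2
    have p3 := cutCap_nonneg S n3; have r3 := cutCap_nonneg Sᶜ n3
    have p4 := cutCap_nonneg S n4; have r4 := cutCap_nonneg Sᶜ n4
    have p5 := cutCap_nonneg S n5; have r5 := cutCap_nonneg Sᶜ n5
    have p6 := cutCap_nonneg S n6; have r6 := cutCap_nonneg Sᶜ n6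
    have z1 := x1 S; have z2 := x2 S; have z3 := x3 S
    have z4 := x4 S; have z5 := x5 S; have z6 := x6 S
    rw [abs_le]
    rcases hi with rfl | rfl | rfl | rfl | rfl | rfl <;> constructor <;> linarith
  constructor
  · intro S hS hS'
    have hs : ∀ x, side S x = 0 ∨ side S x = 1 := by
      intro x; by_cases h : x ∈ S <;> simp [side, h]
    by_contra hlt
    have hsmall : ∀ (k : ℕ) (x y : Fin 6), (a : ℤ) - 1 ≤ k →
        |(k : ℤ) * (side S x - side S y)| ≤ cutCap S cap + cutCap Sᶜ cap →
        side S x = side S y := by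
      intro k x y hk hle
      rcases hs x with h | h <;> rcases hs y with h' | h' <;> rw [h, h'] at hle ⊢ <;>
        simp at hle <;> omega
    have e1 := hsmall k1 1 0 (by omega) (main S _ (by simp))
    have e2 := hsmall k2 1 2 (by omega) (main S _ (by simp))
    have e3 := hsmall k3 3 2 (by omega) (main S _ (by simp))
    have e4 := hsmall k4 3 4 (by omega) (main S _ (by simp))
    have e5 := hsmall k5 5 4 (by omega) (main S _ (by simp))
    have hall : ∀ x, side S x = side S 0 := by
      intro x
      fin_cases x <;> simp only [Fin.zero_eta, Fin.mk_one, Fin.reduceFinMk] <;> omega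
    rcases hs 0 with h | h
    · refine hS (Finset.eq_empty_iff_forall_notMem.2 fun x hx => ?_)
      have := hall x
      rw [h] at this
      simp [side, hx] at this
    · refine hS' (Finset.eq_univ_iff_forall.2 fun x => ?_)
      have := hall x
      by_contra hx
      rw [h] at this
      simp [side, hx] at this
  · intro v
    refine le_trans ?_ (main {v} _ (Or.inr (Or.inr (Or.inr (Or.inr (Or.inr rfl))))))
    rw [le_abs]
    fin_cases v <;> simp [side] <;> omega

/-- A tree on at least two vertices has two distinct leaves. -/
lemma two_leaves {V : Type*} [Fintype V] [DecidableEq V] (G : SimpleGraph V)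
    [DecidableRel G.Adj] (hG : G.IsTree) (hV : 2 ≤ Fintype.card V) :
    ∃ v w, v ≠ w ∧ G.degree v = 1 ∧ G.degree w = 1 := by
  have : Nontrivial V := Fintype.one_lt_card_iff_nontrivial.1 hV
  have hpos : ∀ v, 1 ≤ G.degree v := fun v => hG.connected.preconnected.degree_pos_of_nontrivial v
  have hsum := G.sum_degrees_eq_twice_card_edges
  have hcard := hG.card_edgeFinset
  obtain ⟨v, hv⟩ : ∃ v, G.degree v = 1 := by
    by_contra! h
    have : ∑ v : V, 2 ≤ ∑ v, G.degree v :=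
      Finset.sum_le_sum fun v _ => by have := hpos v; have := h v; omega
    simp at this; omega
  by_contra! h
  have h1 : ∑ w ∈ Finset.univ.erase v, 2 ≤ ∑ w ∈ Finset.univ.erase v, G.degree w :=
    Finset.sum_le_sum fun w hw => by
      have := hpos w; have := h v w (Finset.ne_of_mem_erase hw).symm hv; omega
  have h2 := Finset.add_sum_erase Finset.univ (fun w => G.degree w) (Finset.mem_univ v)
  simp at h1 h2; omega

/-- The capital locked on a channel, on both sides together. -/
def edgeCap (c : V → V → ℤ) : Sym2 V → ℤ :=
  Sym2.lift ⟨fun x y => c x y + c y x, fun _ _ => add_comm _ _⟩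

lemma totalCap_eq_sum_edgeCap [Fintype V] [DecidableEq V] (E : Finset (Sym2 V))
    (c : V → V → ℤ) (hsupp : ∀ x y, s(x, y) ∉ E → c x y = 0) (hdiag : ∀ e ∈ E, ¬ e.IsDiag) :
    totalCap c = ∑ e ∈ E, edgeCap c e := by
  unfold totalCap
  rw [← Fintype.sum_prod_type', ← Finset.sum_filter_of_ne (p := fun q : V × V => s(q.1, q.2) ∈ E)
    (fun q _ hq => by by_contra h; exact hq (hsupp _ _ h)),
    ← Finset.sum_fiberwise_of_maps_to (g := fun q : V × V => s(q.1, q.2)) (t := E)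
    (fun q hq => (Finset.mem_filter.1 hq).2)]
  refine Finset.sum_congr rfl fun e he => ?_
  induction e with
  | h u v =>
    have huv : u ≠ v := fun h => hdiag _ he (by simpa using h)
    have : ({q ∈ Finset.univ.filter (fun q : V × V => s(q.1, q.2) ∈ E) | s(q.1, q.2) = s(u, v)} :
        Finset (V × V)) = {(u, v), (v, u)} := by
      ext ⟨x, y⟩
      simp only [Finset.mem_filter, Finset.mem_univ, true_and, Sym2.eq_iff, Finset.mem_insert,
        Finset.mem_singleton, Prod.mk.injEq]
      constructor
      · exact fun h => h.2
      · rintro (⟨rfl, rfl⟩ | ⟨rfl, rfl⟩)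
        · exact ⟨he, by simp⟩
        · exact ⟨by rwa [Sym2.eq_swap], by simp⟩
    rw [this, Finset.sum_pair (by simp [huv])]
    rfl

lemma cutCap_add_compl_le_edgeCap [Fintype V] [DecidableEq V] (E : Finset (Sym2 V))
    (c : V → V → ℤ) (hc : ∀ x y, 0 ≤ c x y) (hsupp : ∀ x y, s(x, y) ∉ E → c x y = 0)
    (S : Finset V) (u v : V)
    (huniq : ∀ x ∈ S, ∀ y ∉ S, s(x, y) ∈ E → x = u ∧ y = v) :
    cutCap S c + cutCap Sᶜ c ≤ edgeCap c s(u, v) := by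
  have bound : ∀ (T : Finset V) (u v : V),
      (∀ x ∈ T, ∀ y ∉ T, s(x, y) ∈ E → x = u ∧ y = v) → cutCap T c ≤ c u v := by
    intro T u v h
    calc cutCap T c
        ≤ ∑ x ∈ T, ∑ y ∈ Tᶜ, if x = u then (if y = v then c u v else 0) else 0 := by
          refine Finset.sum_le_sum fun x hx => Finset.sum_le_sum fun y hy => ?_
          by_cases he : s(x, y) ∈ E
          · obtain ⟨rfl, rfl⟩ := h x hx y (Finset.mem_compl.1 hy) he
            simp
          · rw [hsupp x y he]
            have := hc u v
            split_ifs <;> simp [this]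
      _ ≤ c u v := by
          have := hc u v
          simp only [Finset.sum_ite_irrel, Finset.sum_const_zero, Finset.sum_ite_eq',
            Finset.mem_compl]
          split_ifs <;> simp [this]
  refine add_le_add (bound S u v huniq) (bound Sᶜ v u fun x hx y hy he => ?_)
  exact (huniq y (by simpa using hy) x (by simpa using hx) (by rwa [Sym2.eq_swap])).symm

/-- In an acyclic graph every edge is the only one crossing some proper cut. -/
lemma exists_cut_of_isAcyclic [Fintype V] [DecidableEq V] (E : Finset (Sym2 V))
    (hdiag : ∀ e ∈ E, ¬ e.IsDiag)
    (hacyc : (SimpleGraph.fromEdgeSet (E : Set (Sym2 V))).IsAcyclic) (u v : V)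
    (he : s(u, v) ∈ E) :
    ∃ S : Finset V, u ∈ S ∧ v ∉ S ∧ ∀ x ∈ S, ∀ y ∉ S, s(x, y) ∈ E → x = u ∧ y = v := by
  classical
  set G := SimpleGraph.fromEdgeSet (E : Set (Sym2 V)) with hG
  have hadj : ∀ x y, s(x, y) ∈ E → G.Adj x y := fun x y h => by
    rw [hG, SimpleGraph.fromEdgeSet_adj]
    exact ⟨h, fun hxy => hdiag _ h (by simpa using hxy)⟩
  have hbr := SimpleGraph.isBridge_iff.1
    (SimpleGraph.isAcyclic_iff_forall_isBridge.1 hacyc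
      (show s(u, v) ∈ G.edgeSet from hadj u v he))
  refine ⟨Finset.univ.filter (fun x => (G.deleteEdges {s(u, v)}).Reachable u x), by simp,
    by simpa using hbr, fun x hx y hy hxy => ?_⟩
  simp only [Finset.mem_filter, Finset.mem_univ, true_and] at hx hy
  by_cases hs : s(x, y) = s(u, v)
  · rcases Sym2.eq_iff.1 hs with h | ⟨rfl, rfl⟩
    · exact h
    · exact absurd hx hbr
  · refine absurd (hx.trans (SimpleGraph.Adj.reachable ?_)) hy
    rw [SimpleGraph.deleteEdges_adj]
    exact ⟨hadj x y hxy, by simpa using hs⟩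

/-- A graph in which every proper cut is crossed by an edge is connected. -/
lemma connected_of_forall_cut [Fintype V] [DecidableEq V] [Nonempty V] (G : SimpleGraph V)
    (h : ∀ S : Finset V, S ≠ ∅ → S ≠ Finset.univ → ∃ x ∈ S, ∃ y ∉ S, G.Adj x y) :
    G.Connected := by
  classical
  refine ⟨fun u v => ?_⟩
  by_contra huv
  obtain ⟨x, hx, y, hy, hxy⟩ := h (Finset.univ.filter (G.Reachable u))
    (fun h0 => by
      have : u ∈ Finset.univ.filter (G.Reachable u) := by simp
      simp [h0] at this)
    (fun h1 => by
      have : v ∈ Finset.univ.filter (G.Reachable u) := by rw [h1]; simp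
      exact huv (by simpa using this))
  simp only [Finset.mem_filter, Finset.mem_univ, true_and] at hx hy
  exact hy (hx.trans hxy.reachable)

/-- For `a > 11`, every acyclic network on the six vertices that feasibly executes at
least `6a - 1` of the `6a` transactions has total locked capital at least `7a - 5`,
which is strictly more than `6a + 6`; hence the optimal graph under capital budget
`6a + 6` is not a tree (or forest). -/
theorem acyclic_network_needs_more_capital (a : ℕ) (ha : 11 < a)
    (E : Finset (Sym2 (Fin 6))) (cap : Fin 6 → Fin 6 → ℤ)
    (hnonneg : ∀ x y, 0 ≤ cap x y)
    (hsupp : ∀ x y, s(x, y) ∉ E → cap x y = 0)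
    (hdiag : ∀ e ∈ E, ¬ e.IsDiag)
    (hacyc : (SimpleGraph.fromEdgeSet (E : Set (Sym2 (Fin 6)))).IsAcyclic)
    (P : List (Option (List (Fin 6)))) (hlen : P.length = (cycleTxList a).length)
    (hfeas : Feasible E cap ((cycleTxList a).zip P))
    (hcount : 6 * a - 1 ≤ P.countP (fun o => o.isSome)) :
    (7 * (a : ℤ) - 5) ≤ totalCap cap ∧ (6 * (a : ℤ) + 6) < 7 * (a : ℤ) - 5 := by
  refine ⟨?_, by omega⟩
  obtain ⟨hcut, hstar⟩ := cut_lower_bounds a E cap hnonneg P hlen hfeas hcount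
  classical
  set G := SimpleGraph.fromEdgeSet (E : Set (Sym2 (Fin 6))) with hG
  have hadj : ∀ x y, s(x, y) ∈ E ↔ G.Adj x y := fun x y => by
    rw [hG, SimpleGraph.fromEdgeSet_adj]
    exact ⟨fun h => ⟨h, fun hxy => hdiag _ h (by simpa using hxy)⟩, fun h => h.1⟩
  have hcross : ∀ S : Finset (Fin 6), S ≠ ∅ → S ≠ Finset.univ →
      ∃ x ∈ S, ∃ y ∉ S, G.Adj x y := by
    intro S hS hS'
    by_contra! hno
    have h0 := hcut S hS hS'
    have h1 : cutCap S cap = 0 := Finset.sum_eq_zero fun x hx => Finset.sum_eq_zero fun y hy =>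
      hsupp x y fun h => hno x hx y (by simpa using hy) ((hadj x y).1 h)
    have h2 : cutCap Sᶜ cap = 0 := Finset.sum_eq_zero fun x hx => Finset.sum_eq_zero fun y hy =>
      hsupp x y fun h => hno y (by simpa using hy) x (by simpa using hx) ((hadj x y).1 h).symm
    omega
  have htree : G.IsTree := ⟨connected_of_forall_cut G hcross, hacyc⟩
  have hEG : G.edgeFinset = E := by
    ext e
    induction e with
    | h x y => simp [hadj]
  have hE : E.card = 5 := by
    have := htree.card_edgeFinset
    rw [hEG] at this
    simpa using this
  have hedge : ∀ e ∈ E, (a : ℤ) - 1 ≤ edgeCap cap e := by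
    intro e he
    induction e with
    | h u v =>
      obtain ⟨S, hu, hv, huniq⟩ := exists_cut_of_isAcyclic E hdiag hacyc u v he
      refine (hcut S (Finset.ne_empty_of_mem hu) fun h => hv (h ▸ Finset.mem_univ v)).trans ?_
      exact cutCap_add_compl_le_edgeCap E cap hnonneg hsupp S u v huniq
  have hleaf : ∀ v w, G.Adj v w → G.degree v = 1 → 2 * (a : ℤ) - 1 ≤ edgeCap cap s(v, w) := by
    intro v w hvw hd
    refine (hstar v).trans (cutCap_add_compl_le_edgeCap E cap hnonneg hsupp {v} v w ?_)
    intro x hx y _ hxy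
    obtain rfl := Finset.mem_singleton.1 hx
    exact ⟨rfl, (SimpleGraph.degree_eq_one_iff_existsUnique_adj.1 hd).unique
      ((hadj _ _).1 hxy) hvw⟩
  obtain ⟨v, w, hvw, hv, hw⟩ := two_leaves G htree (by simp)
  obtain ⟨v', hv', hvu⟩ := SimpleGraph.degree_eq_one_iff_existsUnique_adj.1 hv
  obtain ⟨w', hw', hwu⟩ := SimpleGraph.degree_eq_one_iff_existsUnique_adj.1 hw
  have hne : s(v, v') ≠ s(w, w') := by
    intro h
    rcases Sym2.eq_iff.1 h with h | ⟨rfl, rfl⟩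
    · exact hvw h.1
    obtain ⟨x, hx, y, hy, hxy⟩ := hcross {v, v'} (by simp) (fun h => by
      have h1 := congrArg Finset.card h
      have h2 := Finset.card_le_two (a := v) (b := v')
      simp at h1
      omega)
    simp only [Finset.mem_insert, Finset.mem_singleton, not_or] at hx hy
    rcases hx with rfl | rfl
    · exact hy.2 (hvu y hxy)
    · exact hy.1 (hwu y hxy)
  have hsub : ({s(v, v'), s(w, w')} : Finset (Sym2 (Fin 6))) ⊆ E := by
    intro e he
    rcases Finset.mem_insert.1 he with rfl | he
    · exact (hadj _ _).2 hv'
    · rw [Finset.mem_singleton.1 he]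
      exact (hadj _ _).2 hw'
  rw [totalCap_eq_sum_edgeCap E cap hsupp hdiag]
  have hle : ∑ e ∈ ({s(v, v'), s(w, w')} : Finset (Sym2 (Fin 6))), (edgeCap cap e - (a - 1)) ≤
      ∑ e ∈ E, (edgeCap cap e - (a - 1)) :=
    Finset.sum_le_sum_of_subset_of_nonneg hsub fun e he _ => sub_nonneg.2 (hedge e he)
  rw [Finset.sum_pair hne, Finset.sum_sub_distrib, Finset.sum_const, hE] at hle
  have h1 := hleaf v v' hv' hv
  have h2 := hleaf w w' hw' hw
  simp only [nsmul_eq_mul, Nat.cast_ofNat] at hle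
  linarith
end

section
/- Consider the sequence of ten unit-value transactions t_1=(v_4,v_2,1), t_2=(v_4,v_7,1), t_3=(v_2,v_6,1), t_4=(v_5,v_2,1), t_5=(v_6,v_5,1), t_6=(v_4,v_5,1), t_7=(v_3,v_2,1), t_8=(v_2,v_1,1), t_9=(v_1,v_3,1), t_10=(v_3,v_4,1) on the vertex set {v_1,…,v_7}. For every choice of center c ∈ {v_1,…,v_7}, every assignment of nonnegative capitals to the star graph with center c and leaves {v_1,…,v_7}∖{c} that admits a feasible routing executing all ten transactions (each routed via the center, or directly if the center is its sender or receiver) has total locked capital at least 7. Combined with the existence of a tree executing all ten transactions with total locked capital 6, no star graph is an optimal (capital-minimal) solution. -/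
variable {V : Type*}

/-- The tree edge set `{v₁v₂, v₂v₃, v₂v₄, v₄v₇, v₄v₅, v₅v₆}` on vertices `0, …, 6`. -/
def treeE : Finset (Sym2 (Fin 7)) :=
  {s(0, 1), s(1, 2), s(1, 3), s(3, 6), s(3, 4), s(4, 5)}

/-- The ten unit-value transactions
`(v₄,v₂), (v₄,v₇), (v₂,v₆), (v₅,v₂), (v₆,v₅), (v₄,v₅), (v₃,v₂), (v₂,v₁), (v₁,v₃), (v₃,v₄)`
on vertices `0, …, 6`. -/
def tenTxs : List (Txn (Fin 7)) :=
  [⟨3, 1, 1⟩, ⟨3, 6, 1⟩, ⟨1, 5, 1⟩, ⟨4, 1, 1⟩, ⟨5, 4, 1⟩,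
   ⟨3, 4, 1⟩, ⟨2, 1, 1⟩, ⟨1, 0, 1⟩, ⟨0, 2, 1⟩, ⟨2, 3, 1⟩]

theorem step_eq_add [DecidableEq V] (val : ℤ) (u v : V) (c : V → V → ℤ) (x y : V) :
    step val u v c x y = c x y + step val u v 0 x y := by
  simp only [step, Pi.zero_apply]
  split_ifs <;> ring

theorem execPath_eq_add [DecidableEq V] (val : ℤ) (p : List V) (c : V → V → ℤ) (x y : V) :
    execPath val p c x y = c x y + execPath val p 0 x y := by
  induction p generalizing c with
  | nil => simp [execPath]
  | cons u p ih =>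
    cases p with
    | nil => simp [execPath]
    | cons v p =>
      simp only [execPath]
      rw [ih (step val u v c), ih (step val u v 0), step_eq_add val u v c]
      ring

/-- The least initial capital on the side `x` of the channel `{x, y}` which keeps that side
nonnegative throughout the execution of the given routing. -/
def demand [DecidableEq V] : List (Txn V × Option (List V)) → V → V → ℤ
  | [], _, _ => 0
  | (_, none) :: rest, x, y => demand rest x y
  | (t, some p) :: rest, x, y => max 0 (demand rest x y - execPath t.val p 0 x y)

theorem Feasible.demand_le [DecidableEq V] {E : Finset (Sym2 V)}
    {l : List (Txn V × Option (List V))} {c : V → V → ℤ} (h : Feasible E c l)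
    (hc : ∀ x y, 0 ≤ c x y) (x y : V) : demand l x y ≤ c x y := by
  induction l generalizing c with
  | nil => exact hc x y
  | cons a l ih =>
    obtain ⟨t, _ | p⟩ := a
    · exact ih h hc
    · obtain ⟨-, hp, hl⟩ := h
      have := ih hl hp
      rw [execPath_eq_add] at this
      exact max_le (hc x y) (by linarith)

theorem seven_le_totalCap_demand_star (c : Fin 7) :
    7 ≤ totalCap (demand (tenTxs.map fun t => (t, some (starPath c t)))) := by
  revert c
  decide +kernel

/-- The capital assignment on the tree `treeE`, with one unit on one side of each channel. -/
def treeCap (x y : Fin 7) : ℤ :=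
  if (x, y) ∈ [((3 : Fin 7), (1 : Fin 7)), (3, 6), (3, 4), (4, 5), (2, 1), (1, 0)] then 1 else 0

/-- The routing of `tenTxs` along the tree `treeE`. -/
def treeRouting : List (List (Fin 7)) :=
  [[3, 1], [3, 6], [1, 3, 4, 5], [4, 3, 1], [5, 4], [3, 4], [2, 1], [1, 0], [0, 1, 2], [2, 1, 3]]

instance [DecidableEq V] (E : Finset (Sym2 V)) (p : List V) (a b : V) :
    Decidable (IsPathOn E p a b) :=
  inferInstanceAs (Decidable (p.head? = some a ∧ p.getLast? = some b ∧ p.Nodup ∧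
    p.IsChain fun u v => s(u, v) ∈ E))

instance Feasible.decidable [Fintype V] [DecidableEq V] (E : Finset (Sym2 V)) :
    (c : V → V → ℤ) → (l : List (Txn V × Option (List V))) → Decidable (Feasible E c l)
  | _, [] => isTrue trivial
  | c, (_, none) :: rest => Feasible.decidable E c rest
  | c, (t, some p) :: rest =>
    have := Feasible.decidable E (execPath t.val p c) rest
    inferInstanceAs (Decidable (IsPathOn E p t.src t.dst ∧
      (∀ x y, 0 ≤ execPath t.val p c x y) ∧ Feasible E (execPath t.val p c) rest))

/-- For every choice of center, every capital assignment on the star with that center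
that feasibly executes all ten transactions (each routed via the center, or directly
when the center is its sender or receiver) has total locked capital at least `7`;
combined with the tree executing all ten transactions with total locked capital `6`,
no star graph is a capital-minimal solution. -/
theorem star_not_optimal :
    (∀ c : Fin 7, ∀ cap : Fin 7 → Fin 7 → ℤ,
      (∀ x y, 0 ≤ cap x y) →
      (∀ x y, s(x, y) ∉ starEdges c → cap x y = 0) →
      Feasible (starEdges c) cap (tenTxs.map (fun t => (t, some (starPath c t)))) →
      7 ≤ totalCap cap) ∧
    (∃ cap : Fin 7 → Fin 7 → ℤ,
      (∀ x y, 0 ≤ cap x y) ∧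
      (∀ x y, s(x, y) ∉ treeE → cap x y = 0) ∧
      (∃ P : List (List (Fin 7)), P.length = 10 ∧
        Feasible treeE cap (tenTxs.zip (P.map some))) ∧
      totalCap cap = 6) := by
  refine ⟨fun c cap hcap _ h => ?_, treeCap, by decide +kernel, by decide +kernel,
    ⟨treeRouting, rfl, by decide +kernel⟩, by decide +kernel⟩
  exact (seven_le_totalCap_demand_star c).trans
    (Finset.sum_le_sum fun x _ => Finset.sum_le_sum fun y _ => h.demand_le hcap x y)
end

section
/- Consider the single channel with left capital c_L = 5 and right capital c_R = 5. For every deterministic online algorithm A — a function that, given the finite sequence of transaction values seen so far (including the current one), outputs accept or reject, and which never accepts a transaction that would violate feasibility of the set of accepted transactions — and for every n ≥ 2, there exists a sequence of n integer transaction values on which A accepts at most 1 transaction, while there exists a feasible set of size at least n − 1. In particular, no deterministic online algorithm achieves a bounded competitive ratio against an adaptive adversary. -/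
/-- The balance (sum of accepted values) of the deterministic online algorithm `A`
after processing the first `j` values of the sequence `vs`; `A` sees, for the `i`-th
value, the prefix of the sequence up to and including that value. -/
def balAfter (A : List ℤ → Bool) (vs : List ℤ) (j : ℕ) : ℤ :=
  ∑ i ∈ Finset.range j, if A (vs.take (i + 1)) then vs.getD i 0 else 0

/-- The number of transactions accepted by the online algorithm `A` on the sequence `vs`. -/
def acceptedCount (A : List ℤ → Bool) (vs : List ℤ) : ℕ :=
  ((Finset.range vs.length).filter (fun i => A (vs.take (i + 1)) = true)).card

/-- The alternating sequence `1, -1, 1, …` up to index `k`, followed by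
`±5, ∓10, ±10, …`, which an algorithm whose balance is `(-1) ^ k` can never accept. -/
def adversary (k i : ℕ) : ℤ :=
  if i ≤ k then (-1) ^ i else if i = k + 1 then -5 * (-1) ^ i else -10 * (-1) ^ i

/-- The first `n` values of the sequence `adversary k`. -/
def adversaryList (k n : ℕ) : List ℤ :=
  (List.range n).map (adversary k)

theorem length_adversaryList (k n : ℕ) : (adversaryList k n).length = n := by
  simp [adversaryList]

theorem getD_adversaryList {k n i : ℕ} (h : i < n) :
    (adversaryList k n).getD i 0 = adversary k i := by
  simp [adversaryList, List.getD_eq_getElem?_getD, h]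

theorem take_adversaryList {k n m : ℕ} (h : m ≤ n) :
    (adversaryList k n).take m = adversaryList k m := by
  simp [adversaryList, ← List.map_take, List.take_range, h]

theorem adversaryList_eq_of_le {k l m : ℕ} (hk : m ≤ k + 1) (hl : m ≤ l + 1) :
    adversaryList k m = adversaryList l m := by
  refine List.map_congr_left fun i hi => ?_
  have hi := List.mem_range.1 hi
  simp [adversary, show i ≤ k by omega, show i ≤ l by omega]

theorem balAfter_adversaryList (A : List ℤ → Bool) {k n j : ℕ} (h : j ≤ n) :
    balAfter A (adversaryList k n) j =
      ∑ i ∈ Finset.range j, if A (adversaryList k (i + 1)) then adversary k i else 0 := by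
  refine Finset.sum_congr rfl fun i hi => ?_
  have hi := Finset.mem_range.1 hi
  rw [take_adversaryList (by omega), getD_adversaryList (by omega)]

/-- An algorithm accepting `adversary k` for the first time at index `k` rejects
everything afterwards. -/
theorem rejects_after_first_accept (A : List ℤ → Bool)
    (hA : ∀ vs : List ℤ, ∀ j < vs.length, A (vs.take (j + 1)) = true →
      -5 ≤ balAfter A vs (j + 1) ∧ balAfter A vs (j + 1) ≤ 5)
    {k : ℕ} (hlt : ∀ i < k, A (adversaryList k (i + 1)) = false)
    (hk : A (adversaryList k (k + 1)) = true) (j : ℕ) (hj : k < j) :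
    A (adversaryList k (j + 1)) = false := by
  induction j using Nat.strong_induction_on with
  | _ j ih =>
    by_contra hacc
    rw [Bool.not_eq_false] at hacc
    have hb := hA (adversaryList k (j + 1)) j (by simp [length_adversaryList])
      (by rwa [take_adversaryList le_rfl])
    have hbefore : (∑ i ∈ Finset.range j,
        if A (adversaryList k (i + 1)) then adversary k i else 0) = (-1) ^ k := by
      rw [Finset.sum_eq_single_of_mem k (Finset.mem_range.2 hj)]
      · simp [hk, adversary]
      · intro i hi hik
        have hi := Finset.mem_range.1 hi
        have hrej : A (adversaryList k (i + 1)) = false := by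
          rcases Nat.lt_or_gt_of_ne hik with h | h
          · exact hlt i h
          · exact ih i hi h
        simp [hrej]
    rw [balAfter_adversaryList A le_rfl, Finset.sum_range_succ, hbefore, if_pos hacc] at hb
    rw [adversary, if_neg (by omega)] at hb
    split_ifs at hb with hjk
    · subst hjk
      rcases neg_one_pow_eq_or ℤ k with h | h <;> simp [pow_succ, h] at hb
    · rcases neg_one_pow_eq_or ℤ k with h | h <;>
        rcases neg_one_pow_eq_or ℤ j with h' | h' <;> simp [h, h'] at hb

/-- The indices below `n` accepted offline on the sequence `adversary k`. -/
def offlineSet (k n : ℕ) : Finset ℕ :=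
  (Finset.range n).filter fun i => i ≠ k ∨ Odd k

theorem le_card_offlineSet (k n : ℕ) : n - 1 ≤ (offlineSet k n).card := by
  have hsub : (Finset.range n).erase k ⊆ offlineSet k n := by
    intro i hi
    simp_all [offlineSet]
  have := Finset.pred_card_le_card_erase (s := Finset.range n) (a := k)
  rw [Finset.card_range] at this
  exact this.trans (Finset.card_le_card hsub)

theorem sum_offlineSet (k j : ℕ) :
    ∑ i ∈ offlineSet k j, adversary k i =
      if j ≤ k then (if Even j then 0 else 1) else if j = k + 1 then 0 else 5 * (-1) ^ j := by
  induction j with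
  | zero => simp [offlineSet]
  | succ j ih =>
    rw [offlineSet, Finset.sum_filter] at ih ⊢
    rw [Finset.sum_range_succ, ih, adversary]
    rcases lt_trichotomy j k with h | rfl | h
    · rcases Nat.even_or_odd j with hj | hj
      · simp [h.le, h.ne, Nat.succ_le_of_lt h, hj, hj.neg_one_pow]
      · simp [h.le, h.ne, Nat.succ_le_of_lt h, hj, hj.neg_one_pow,
          Nat.not_even_iff_odd.2 hj]
    · rcases Nat.even_or_odd j with hj | hj
      · simp [hj]
      · simp [hj, hj.neg_one_pow, Nat.not_even_iff_odd.2 hj]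
    · by_cases hjk : j = k + 1
      · subst hjk
        simp [pow_succ]
      · simp only [h.not_ge, h.ne', hjk, if_false, show ¬ j + 1 ≤ k by omega,
          show ¬ j + 1 = k + 1 by omega, ne_eq, not_false_eq_true, true_or, if_true, pow_succ]
        ring

theorem sum_offlineSet_mem_Icc (k j : ℕ) :
    ∑ i ∈ offlineSet k j, adversary k i ∈ Set.Icc (-5) 5 := by
  rw [sum_offlineSet]
  rcases neg_one_pow_eq_or ℤ j with h | h <;> rw [h] <;> split_ifs <;> simp

theorem filter_offlineSet {k n j : ℕ} (h : j ≤ n) :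
    (offlineSet k n).filter (· < j) = offlineSet k j := by
  ext i
  simp only [offlineSet, Finset.mem_filter, Finset.mem_range]
  constructor
  · exact fun hi => ⟨hi.2, hi.1.2⟩
  · exact fun hi => ⟨⟨hi.1.trans_le h, hi.2⟩, hi.1⟩

theorem exists_acceptedCount_adversaryList_le_one (A : List ℤ → Bool)
    (hA : ∀ vs : List ℤ, ∀ j < vs.length, A (vs.take (j + 1)) = true →
      -5 ≤ balAfter A vs (j + 1) ∧ balAfter A vs (j + 1) ≤ 5) (n : ℕ) :
    ∃ k, acceptedCount A (adversaryList k n) ≤ 1 := by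
  suffices h : ∃ k, ∀ i < n, A (adversaryList k (i + 1)) = true → i = k by
    obtain ⟨k, hk⟩ := h
    refine ⟨k, (Finset.card_le_card (t := {k}) fun i hi => ?_).trans (Finset.card_singleton k).le⟩
    rw [length_adversaryList, Finset.mem_filter, Finset.mem_range] at hi
    rw [take_adversaryList (by omega)] at hi
    exact Finset.mem_singleton.2 (hk i hi.1 hi.2)
  by_cases h : ∃ k, A (adversaryList k (k + 1)) = true
  · classical
    have hlt : ∀ i < Nat.find h, A (adversaryList (Nat.find h) (i + 1)) = false := by
      intro i hi
      rw [adversaryList_eq_of_le (l := i) (by omega) le_rfl]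
      simpa using Nat.find_min h hi
    refine ⟨Nat.find h, fun i _ hacc => ?_⟩
    rcases lt_trichotomy i (Nat.find h) with hi | hi | hi
    · simp [hlt i hi] at hacc
    · exact hi
    · simp [rejects_after_first_accept A hA hlt (Nat.find_spec h) i hi] at hacc
  · refine ⟨n, fun i hi hacc => (h ⟨i, ?_⟩).elim⟩
    rwa [adversaryList_eq_of_le (l := i) (by omega) le_rfl] at hacc

/-- On a single channel with `c_L = c_R = 5`: for every deterministic online algorithm
`A` that never accepts a transaction violating feasibility (whenever it accepts, the
running balance stays in `[-5, 5]`), and every `n ≥ 2`, there is a sequence of `n`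
values on which `A` accepts at most one transaction, while some feasible set (every
prefix partial sum in `[-5, 5]`) has size at least `n - 1`. Hence no deterministic
online algorithm is competitive against an adaptive adversary. -/
theorem no_competitive_online_algorithm (A : List ℤ → Bool)
    (hA : ∀ vs : List ℤ, ∀ j < vs.length, A (vs.take (j + 1)) = true →
      -5 ≤ balAfter A vs (j + 1) ∧ balAfter A vs (j + 1) ≤ 5) :
    ∀ n : ℕ, 2 ≤ n → ∃ vs : List ℤ, vs.length = n ∧
      acceptedCount A vs ≤ 1 ∧
      ∃ S : Finset ℕ, S ⊆ Finset.range n ∧ n - 1 ≤ S.card ∧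
        ∀ j : ℕ, j ≤ n →
          -5 ≤ ∑ i ∈ S.filter (· < j), vs.getD i 0 ∧
            ∑ i ∈ S.filter (· < j), vs.getD i 0 ≤ 5 := by
  intro n _
  obtain ⟨k, hk⟩ := exists_acceptedCount_adversaryList_le_one A hA n
  refine ⟨adversaryList k n, length_adversaryList k n, hk, offlineSet k n,
    Finset.filter_subset _ _, le_card_offlineSet k n, fun j hj => ?_⟩
  have hsum : ∑ i ∈ (offlineSet k n).filter (· < j), (adversaryList k n).getD i 0 =
      ∑ i ∈ offlineSet k j, adversary k i := by
    rw [filter_offlineSet hj]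
    refine Finset.sum_congr rfl fun i hi => getD_adversaryList ?_
    exact (Finset.mem_range.1 (Finset.mem_filter.1 hi).1).trans_le hj
  rw [hsum]
  exact sum_offlineSet_mem_Icc k j
end

section
/- Consider the doubling capital-update process on a single channel edge: the capacity starts at 0; given a sequence of positive integer demands d_1,…,d_n processed in order, if the current capacity is strictly less than d_i then a refund occurs and the capacity increases by 2d_i, otherwise the capacity is unchanged. Let D = max_{1≤i≤n} d_i. Then (i) at every point in time the capacity is at most 3D, and (ii) if the process performs r ≥ 1 refunds in total, then 2·3^{r−1} < 3D; in particular the number of refunds is O(log D). -/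
/-- The doubling capital-update process: starting from capacity `c`, process the
demands in order; if the current capacity is strictly below the demand `d`, a refund
occurs and the capacity increases by `2d`, otherwise it is unchanged. This returns
the final capacity. -/
def capRun : ℕ → List ℕ → ℕ
  | c, [] => c
  | c, d :: ds => if c < d then capRun (c + 2 * d) ds else capRun c ds

/-- The number of refunds performed by the doubling capital-update process started at
capacity `c` on the given list of demands. -/
def refundRun : ℕ → List ℕ → ℕ
  | _, [] => 0
  | c, d :: ds => if c < d then 1 + refundRun (c + 2 * d) ds else refundRun c ds

theorem le_foldr_max_of_mem {ds : List ℕ} {d : ℕ} (h : d ∈ ds) : d ≤ ds.foldr max 0 := by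
  induction ds with
  | nil => simp at h
  | cons a as ih =>
    rcases List.mem_cons.mp h with rfl | h
    · exact le_max_left _ _
    · exact (ih h).trans (le_max_right _ _)

theorem capRun_succ_le {D : ℕ} (ds : List ℕ) (hD : ∀ d ∈ ds, d ≤ D) (c : ℕ) :
    capRun c ds + 1 ≤ max (c + 1) (3 * D) := by
  induction ds generalizing c with
  | nil => exact le_max_left _ _
  | cons a as ih =>
    have ha : a ≤ D := hD a List.mem_cons_self
    have ih' := ih fun d hd => hD d (List.mem_cons_of_mem a hd)
    rw [capRun]
    split_ifs with h
    · have := ih' (c + 2 * a)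
      omega
    · exact ih' c

theorem three_pow_refundRun_mul_le (ds : List ℕ) (c : ℕ) :
    3 ^ refundRun c ds * (c + 1) ≤ capRun c ds + 1 := by
  induction ds generalizing c with
  | nil => simp [refundRun, capRun]
  | cons a as ih =>
    rw [refundRun, capRun]
    split_ifs with h
    · calc 3 ^ (1 + refundRun (c + 2 * a) as) * (c + 1)
          = 3 ^ refundRun (c + 2 * a) as * (3 * (c + 1)) := by ring
        _ ≤ 3 ^ refundRun (c + 2 * a) as * (c + 2 * a + 1) :=
          Nat.mul_le_mul_left _ (by omega)
        _ ≤ _ := ih _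
    · exact ih c

/-- For positive demands with maximum `D`: (i) at every point in time (i.e. after any
prefix of the demands) the capacity of the doubling process started at `0` is at most
`3D`, and (ii) if the process performs `r ≥ 1` refunds in total then `2·3^(r-1) < 3D`;
in particular the number of refunds is `O(log D)`. -/
theorem doubling_process_bounds (ds : List ℕ) (hpos : ∀ d ∈ ds, 0 < d) :
    (∀ p : List ℕ, p <+: ds → capRun 0 p ≤ 3 * ds.foldr max 0) ∧
    (1 ≤ refundRun 0 ds → 2 * 3 ^ (refundRun 0 ds - 1) < 3 * ds.foldr max 0) := by
  refine ⟨fun p hp => ?_, fun hr => ?_⟩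
  · have := capRun_succ_le p (fun d hd => le_foldr_max_of_mem (hp.subset hd)) 0
    omega
  · have hcap := capRun_succ_le ds (fun d hd => le_foldr_max_of_mem hd) 0
    have hlow := three_pow_refundRun_mul_le ds 0
    obtain ⟨k, hk⟩ := Nat.exists_eq_add_of_le' hr
    rw [hk, pow_succ] at hlow
    rw [hk, Nat.add_sub_cancel]
    have : 0 < 3 ^ k := by positivity
    omega
end

section
/- Let s_1,…,s_m be positive integers with even sum v = Σ_{i=1}^m s_i. Consider the graph G on vertices {b,c,d,e} with edge set {{e,b},{b,d},{d,c},{e,c}} and the sequence of m+4 transactions, in order: (d,b,v/2), (b,e,v/2), (d,c,v/2), (c,e,v/2), followed by (e,d,s_1), (e,d,s_2), …, (e,d,s_m), where each transaction from e to d must be routed along one of the two paths e–b–d or e–c–d and every other transaction along a path in G. Then there exist capitals on the edges of G with total locked capital at most 2v and a feasible routing executing all m+4 transactions if and only if there exists a subset A' ⊆ {1,…,m} with Σ_{i∈A'} s_i = Σ_{i∉A'} s_i = v/2. -/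
variable {V : Type*}

/-- The edge set `{eb, bd, dc, ec}` of the restriction graph on the four vertices
`b = 0`, `c = 1`, `d = 2`, `e = 3`. -/
def gE : Finset (Sym2 (Fin 4)) := {s(3, 0), s(0, 2), s(2, 1), s(3, 1)}

/-- The `m + 4` transactions of the Partition reduction, in order:
`(d,b,v/2), (b,e,v/2), (d,c,v/2), (c,e,v/2)` followed by `(e,d,s₁), …, (e,d,sₘ)`
(with `b = 0`, `c = 1`, `d = 2`, `e = 3`). -/
def partitionTxs (m : ℕ) (sz : Fin m → ℕ) (v : ℕ) : List (Txn (Fin 4)) :=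
  [⟨2, 0, ((v / 2 : ℕ) : ℤ)⟩, ⟨0, 3, ((v / 2 : ℕ) : ℤ)⟩,
   ⟨2, 1, ((v / 2 : ℕ) : ℤ)⟩, ⟨1, 3, ((v / 2 : ℕ) : ℤ)⟩] ++
    List.ofFn (fun i => (⟨3, 2, (sz i : ℤ)⟩ : Txn (Fin 4)))

instance (E : Finset (Sym2 (Fin 4))) (p : List (Fin 4)) (a b : Fin 4) :
    Decidable (IsPathOn E p a b) :=
  inferInstanceAs (Decidable (p.head? = some a ∧ p.getLast? = some b ∧ p.Nodup ∧
    p.IsChain (fun u v => s(u, v) ∈ E)))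

set_option synthInstance.maxSize 4096 in
set_option synthInstance.maxHeartbeats 400000 in
lemma isPathOn_gE_cases {p : List (Fin 4)} {a b : Fin 4} (h : IsPathOn gE p a b) :
    (a = 2 → b = 0 → p = [2, 0] ∨ p = [2, 1, 3, 0]) ∧
    (a = 0 → b = 3 → p = [0, 3] ∨ p = [0, 2, 1, 3]) ∧
    (a = 2 → b = 1 → p = [2, 1] ∨ p = [2, 0, 3, 1]) ∧
    (a = 1 → b = 3 → p = [1, 3] ∨ p = [1, 2, 0, 3]) ∧
    (a = 3 → b = 2 → p = [3, 0, 2] ∨ p = [3, 1, 2]) := by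
  obtain ⟨ha, hb, hn, hc⟩ := h
  change p.IsChain _ at hc
  have hlen : p.length ≤ 4 := by simpa using hn.length_le_card
  rcases p with _ | ⟨x, _ | ⟨y, _ | ⟨z, _ | ⟨w, _ | ⟨u, l⟩⟩⟩⟩⟩
  · simp at ha
  · simp at ha hb
    subst ha hb
    revert x
    decide
  · simp at ha hb
    subst ha hb
    clear hlen
    revert x y
    decide
  · simp at ha hb
    subst ha hb
    clear hlen
    revert x y z
    decide
  · simp at ha hb
    subst ha hb
    clear hlen
    revert x y z w
    decide
  · simp only [List.length_cons] at hlen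
    omega

/-- The capitals `c` after net flows of `α`, `β`, `γ`, `δ` along `d → b`, `b → e`, `d → c`
and `c → e`, respectively. -/
def shift (c : Fin 4 → Fin 4 → ℤ) (α β γ δ : ℤ) : Fin 4 → Fin 4 → ℤ :=
  ![![c 0 0, c 0 1, c 0 2 + α, c 0 3 - β],
    ![c 1 0, c 1 1, c 1 2 + γ, c 1 3 - δ],
    ![c 2 0 - α, c 2 1 - γ, c 2 2, c 2 3],
    ![c 3 0 + β, c 3 1 + δ, c 3 2, c 3 3]]

section shift

variable (c : Fin 4 → Fin 4 → ℤ) (α β γ δ x : ℤ)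

lemma shift_02 : shift c α β γ δ 0 2 = c 0 2 + α := rfl
lemma shift_20 : shift c α β γ δ 2 0 = c 2 0 - α := rfl
lemma shift_03 : shift c α β γ δ 0 3 = c 0 3 - β := rfl
lemma shift_30 : shift c α β γ δ 3 0 = c 3 0 + β := rfl
lemma shift_12 : shift c α β γ δ 1 2 = c 1 2 + γ := rfl
lemma shift_21 : shift c α β γ δ 2 1 = c 2 1 - γ := rfl
lemma shift_13 : shift c α β γ δ 1 3 = c 1 3 - δ := rfl
lemma shift_31 : shift c α β γ δ 3 1 = c 3 1 + δ := rfl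

lemma shift_nonneg_iff (hc : ∀ x y, 0 ≤ c x y) : (∀ x y, 0 ≤ shift c α β γ δ x y) ↔
    0 ≤ c 0 2 + α ∧ 0 ≤ c 2 0 - α ∧ 0 ≤ c 0 3 - β ∧ 0 ≤ c 3 0 + β ∧
    0 ≤ c 1 2 + γ ∧ 0 ≤ c 2 1 - γ ∧ 0 ≤ c 1 3 - δ ∧ 0 ≤ c 3 1 + δ := by
  constructor
  · exact fun h => ⟨h 0 2, h 2 0, h 0 3, h 3 0, h 1 2, h 2 1, h 1 3, h 3 1⟩
  · rintro ⟨h02, h20, h03, h30, h12, h21, h13, h31⟩ x y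
    fin_cases x <;> fin_cases y <;> first | assumption | exact hc _ _

lemma execPath_db : execPath x [2, 0] c = shift c x 0 0 0 := by
  ext i j; fin_cases i <;> fin_cases j <;> simp [execPath, step, shift]

lemma execPath_dceb : execPath x [2, 1, 3, 0] c = shift c 0 (-x) x x := by
  ext i j; fin_cases i <;> fin_cases j <;> simp [execPath, step, shift, sub_eq_add_neg]

lemma execPath_be : execPath x [0, 3] c = shift c 0 x 0 0 := by
  ext i j; fin_cases i <;> fin_cases j <;> simp [execPath, step, shift]

lemma execPath_bdce : execPath x [0, 2, 1, 3] c = shift c (-x) 0 x x := by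
  ext i j; fin_cases i <;> fin_cases j <;> simp [execPath, step, shift, sub_eq_add_neg]

lemma execPath_dc : execPath x [2, 1] c = shift c 0 0 x 0 := by
  ext i j; fin_cases i <;> fin_cases j <;> simp [execPath, step, shift]

lemma execPath_dbec : execPath x [2, 0, 3, 1] c = shift c x x 0 (-x) := by
  ext i j; fin_cases i <;> fin_cases j <;> simp [execPath, step, shift, sub_eq_add_neg]

lemma execPath_ce : execPath x [1, 3] c = shift c 0 0 0 x := by
  ext i j; fin_cases i <;> fin_cases j <;> simp [execPath, step, shift]

lemma execPath_cdbe : execPath x [1, 2, 0, 3] c = shift c x x (-x) 0 := by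
  ext i j; fin_cases i <;> fin_cases j <;> simp [execPath, step, shift, sub_eq_add_neg]

lemma execPath_ebd : execPath x [3, 0, 2] c = shift c (-x) (-x) 0 0 := by
  ext i j; fin_cases i <;> fin_cases j <;> simp [execPath, step, shift, sub_eq_add_neg]

lemma execPath_ecd : execPath x [3, 1, 2] c = shift c 0 0 (-x) (-x) := by
  ext i j; fin_cases i <;> fin_cases j <;> simp [execPath, step, shift, sub_eq_add_neg]

end shift

lemma exists_split_of_feasible (m : ℕ) (sz : Fin m → ℕ) (cap : Fin 4 → Fin 4 → ℤ)
    (hcap : ∀ x y, 0 ≤ cap x y) (P : List (List (Fin 4))) (hP : P.length = m)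
    (hF : Feasible gE cap
      ((List.ofFn fun i => (⟨3, 2, (sz i : ℤ)⟩ : Txn (Fin 4))).zip (P.map some))) :
    ∃ f : Fin m → Bool, ∑ i, (if f i then (sz i : ℤ) else 0) ≤ cap 3 0 ∧
      ∑ i, (if f i then 0 else (sz i : ℤ)) ≤ cap 3 1 := by
  induction m generalizing cap P with
  | zero => exact ⟨fun _ => true, by simpa using hcap 3 0, by simpa using hcap 3 1⟩
  | succ m ih =>
    obtain _ | ⟨p, P⟩ := P
    · simp at hP
    rw [List.ofFn_succ, List.map_cons, List.zip_cons_cons] at hF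
    obtain ⟨hpath, hnn, hrest⟩ := hF
    obtain ⟨f, hf0, hf1⟩ := ih (fun i => sz i.succ) _ hnn P (by simpa using hP) hrest
    rcases (isPathOn_gE_cases hpath).2.2.2.2 rfl rfl with rfl | rfl
    · rw [execPath_ebd] at hf0 hf1
      rw [shift_30] at hf0
      rw [shift_31] at hf1
      refine ⟨Fin.cons true f, ?_, ?_⟩ <;> simp [Fin.sum_univ_succ] <;> linarith
    · rw [execPath_ecd] at hf0 hf1
      rw [shift_30] at hf0
      rw [shift_31] at hf1
      refine ⟨Fin.cons false f, ?_, ?_⟩ <;> simp [Fin.sum_univ_succ] <;> linarith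

lemma feasible_of_split (m : ℕ) (sz : Fin m → ℕ) (cap : Fin 4 → Fin 4 → ℤ)
    (hcap : ∀ x y, 0 ≤ cap x y) (f : Fin m → Bool)
    (h30 : ∑ i, (if f i then (sz i : ℤ) else 0) ≤ cap 3 0)
    (h02 : ∑ i, (if f i then (sz i : ℤ) else 0) ≤ cap 0 2)
    (h31 : ∑ i, (if f i then 0 else (sz i : ℤ)) ≤ cap 3 1)
    (h12 : ∑ i, (if f i then 0 else (sz i : ℤ)) ≤ cap 1 2) :
    Feasible gE cap ((List.ofFn fun i => (⟨3, 2, (sz i : ℤ)⟩ : Txn (Fin 4))).zip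
      ((List.ofFn fun i => if f i then [3, 0, 2] else [3, 1, 2]).map some)) := by
  induction m generalizing cap with
  | zero => simp [Feasible]
  | succ m ih =>
    rw [List.ofFn_succ, List.ofFn_succ, List.map_cons, List.zip_cons_cons]
    rw [Fin.sum_univ_succ] at h30 h02 h31 h12
    have hA : 0 ≤ ∑ i : Fin m, (if f i.succ then (sz i.succ : ℤ) else 0) :=
      Finset.sum_nonneg fun i _ => by split_ifs <;> positivity
    have hB : 0 ≤ ∑ i : Fin m, (if f i.succ then 0 else (sz i.succ : ℤ)) :=
      Finset.sum_nonneg fun i _ => by split_ifs <;> positivity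
    have hs : (0 : ℤ) ≤ sz 0 := by positivity
    have h20 := hcap 2 0
    have h03 := hcap 0 3
    have h21 := hcap 2 1
    have h13 := hcap 1 3
    cases hf : f 0 <;> simp only [hf, if_true, if_false, Bool.false_eq_true] at *
    · have hnn : ∀ x y, 0 ≤ execPath (sz 0 : ℤ) [3, 1, 2] cap x y := by
        rw [execPath_ecd, shift_nonneg_iff _ _ _ _ _ hcap]
        refine ⟨?_, ?_, ?_, ?_, ?_, ?_, ?_, ?_⟩ <;> linarith
      refine ⟨show IsPathOn gE [3, 1, 2] 3 2 by decide, hnn,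
        ih (fun i => sz i.succ) _ hnn (fun i => f i.succ) ?_ ?_ ?_ ?_⟩ <;>
        simp only [execPath_ecd, shift_30, shift_02, shift_31, shift_12] <;> linarith
    · have hnn : ∀ x y, 0 ≤ execPath (sz 0 : ℤ) [3, 0, 2] cap x y := by
        rw [execPath_ebd, shift_nonneg_iff _ _ _ _ _ hcap]
        refine ⟨?_, ?_, ?_, ?_, ?_, ?_, ?_, ?_⟩ <;> linarith
      refine ⟨show IsPathOn gE [3, 0, 2] 3 2 by decide, hnn,
        ih (fun i => sz i.succ) _ hnn (fun i => f i.succ) ?_ ?_ ?_ ?_⟩ <;>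
        simp only [execPath_ebd, shift_30, shift_02, shift_31, shift_12] <;> linarith

/-- The total capital of a network whose capitals vanish outside `gE`. -/
lemma totalCap_gE {cap : Fin 4 → Fin 4 → ℤ} (h0 : ∀ x y, s(x, y) ∉ gE → cap x y = 0) :
    totalCap cap = cap 0 2 + cap 2 0 + cap 0 3 + cap 3 0 + cap 1 2 + cap 2 1 +
      cap 1 3 + cap 3 1 := by
  simp only [totalCap, Fin.sum_univ_four, h0 0 0 (by decide), h0 1 1 (by decide),
    h0 2 2 (by decide), h0 3 3 (by decide), h0 0 1 (by decide), h0 1 0 (by decide),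
    h0 2 3 (by decide), h0 3 2 (by decide)]
  ring

lemma edge_nonneg {c : Fin 4 → Fin 4 → ℤ} (h : ∀ x y, 0 ≤ c x y) :
    0 ≤ c 0 2 ∧ 0 ≤ c 2 0 ∧ 0 ≤ c 0 3 ∧ 0 ≤ c 3 0 ∧
    0 ≤ c 1 2 ∧ 0 ≤ c 2 1 ∧ 0 ≤ c 1 3 ∧ 0 ≤ c 3 1 :=
  ⟨h 0 2, h 2 0, h 0 3, h 3 0, h 1 2, h 2 1, h 1 3, h 3 1⟩

/-- The capitals that just suffice to route the first four transactions directly. -/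
def directCap (h : ℤ) : Fin 4 → Fin 4 → ℤ :=
  ![![0, 0, 0, h], ![0, 0, 0, h], ![h, h, 0, 0], ![0, 0, 0, 0]]

/-- Let `s₁, …, sₘ` be positive integers with even sum `v`. There exist capitals on
the edges of the graph `{eb, bd, dc, ec}` with total locked capital at most `2v`
together with a feasible routing executing all `m + 4` transactions (each `e → d`
transaction necessarily travels along `e–b–d` or `e–c–d`) if and only if some subset
of the `sᵢ` sums to `v / 2` (equivalently, the `sᵢ` can be partitioned into two
halves of equal sum). -/
theorem partition_reduction (m : ℕ) (sz : Fin m → ℕ) (hpos : ∀ i, 0 < sz i)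
    (v : ℕ) (hv : v = ∑ i, sz i) (heven : 2 ∣ v) :
    (∃ cap : Fin 4 → Fin 4 → ℤ,
      (∀ x y, 0 ≤ cap x y) ∧
      (∀ x y, s(x, y) ∉ gE → cap x y = 0) ∧
      totalCap cap ≤ 2 * (v : ℤ) ∧
      ∃ P : List (List (Fin 4)), P.length = m + 4 ∧
        Feasible gE cap ((partitionTxs m sz v).zip (P.map some))) ↔
    (∃ A : Finset (Fin m), ∑ i ∈ A, sz i = v / 2) := by
  obtain ⟨h, rfl⟩ := heven
  have hh : 2 * h / 2 = h := by omega
  simp only [partitionTxs, hh]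
  have hsum (f : Fin m → Bool) : ∑ i, (if f i then (sz i : ℤ) else 0) +
      ∑ i, (if f i then 0 else (sz i : ℤ)) = 2 * h := by
    have hcast : ((2 * h : ℕ) : ℤ) = ∑ i, (sz i : ℤ) := by rw [hv]; push_cast; rfl
    push_cast at hcast
    rw [hcast, ← Finset.sum_add_distrib]
    exact Finset.sum_congr rfl fun i _ => by split_ifs <;> simp
  constructor
  · rintro ⟨cap, hcap, h0, htot, P, hP, hF⟩
    rw [totalCap_gE h0] at htot
    obtain _ | ⟨p₁, _ | ⟨p₂, _ | ⟨p₃, _ | ⟨p₄, P⟩⟩⟩⟩ := P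
    iterate 4 simp only [List.length_cons, List.length_nil] at hP; omega
    simp only [List.map_cons, List.cons_append, List.nil_append, List.zip_cons_cons] at hF
    obtain ⟨hp₁, hn₁, hp₂, hn₂, hp₃, hn₃, hp₄, hn₄, hF⟩ := hF
    obtain ⟨f, hf0, hf1⟩ := exists_split_of_feasible m sz _ hn₄ P (by simpa using hP) hF
    have key : execPath (h : ℤ) p₄ (execPath h p₃ (execPath h p₂ (execPath h p₁ cap))) 3 0 ≤ h ∧
        execPath (h : ℤ) p₄ (execPath h p₃ (execPath h p₂ (execPath h p₁ cap))) 3 1 ≤ h := by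
      clear hf0 hf1 hF h0
      apply edge_nonneg at hcap
      apply edge_nonneg at hn₁
      apply edge_nonneg at hn₂
      apply edge_nonneg at hn₃
      apply edge_nonneg at hn₄
      rcases (isPathOn_gE_cases hp₁).1 rfl rfl with rfl | rfl <;>
      rcases (isPathOn_gE_cases hp₂).2.1 rfl rfl with rfl | rfl <;>
      rcases (isPathOn_gE_cases hp₃).2.2.1 rfl rfl with rfl | rfl <;>
      rcases (isPathOn_gE_cases hp₄).2.2.2.1 rfl rfl with rfl | rfl <;>
      · clear hp₁ hp₂ hp₃ hp₄
        simp only [execPath_db, execPath_dceb, execPath_be, execPath_bdce, execPath_dc,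
          execPath_dbec, execPath_ce, execPath_cdbe, shift_02, shift_20, shift_03, shift_30,
          shift_12, shift_21, shift_13, shift_31] at hn₁ hn₂ hn₃ hn₄ ⊢
        push_cast at htot
        constructor <;> linarith
    have hs := hsum f
    refine ⟨Finset.univ.filter fun i => f i = true, ?_⟩
    rw [Finset.sum_filter]
    zify
    linarith [key.1, key.2]
  · rintro ⟨A, hA⟩
    have hs := hsum fun i => decide (i ∈ A)
    have hA' : ∑ i, (if decide (i ∈ A) = true then (sz i : ℤ) else 0) = h := by
      simp only [decide_eq_true_eq, Finset.sum_ite_mem, Finset.univ_inter]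
      exact_mod_cast hA
    have hpos' : (0 : ℤ) ≤ h := by positivity
    have h0 : ∀ x y, s(x, y) ∉ gE → directCap h x y = 0 := by
      intro x y hxy
      fin_cases x <;> fin_cases y <;> first | rfl | exact absurd (by decide) hxy
    have hn : ∀ x y, 0 ≤ directCap h x y := by
      intro x y
      fin_cases x <;> fin_cases y <;> first | exact le_rfl | exact hpos'
    have hn₁ : ∀ x y, 0 ≤ execPath h [2, 0] (directCap h) x y := by
      rw [execPath_db, shift_nonneg_iff _ _ _ _ _ hn]
      simp [directCap]
    have hn₂ : ∀ x y, 0 ≤ execPath h [0, 3] (execPath h [2, 0] (directCap h)) x y := by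
      rw [execPath_be, shift_nonneg_iff _ _ _ _ _ hn₁]
      simp [execPath_db, shift, directCap]
    have hn₃ : ∀ x y, 0 ≤ execPath h [2, 1]
        (execPath h [0, 3] (execPath h [2, 0] (directCap h))) x y := by
      rw [execPath_dc, shift_nonneg_iff _ _ _ _ _ hn₂]
      simp [execPath_db, execPath_be, shift, directCap]
    have hn₄ : ∀ x y, 0 ≤ execPath h [1, 3] (execPath h [2, 1]
        (execPath h [0, 3] (execPath h [2, 0] (directCap h)))) x y := by
      rw [execPath_ce, shift_nonneg_iff _ _ _ _ _ hn₃]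
      simp [execPath_db, execPath_be, execPath_dc, shift, directCap]
    refine ⟨directCap h, hn, h0, ?_, [2, 0] :: [0, 3] :: [2, 1] :: [1, 3] ::
      List.ofFn fun i => if decide (i ∈ A) then [3, 0, 2] else [3, 1, 2], by simp, ?_⟩
    · rw [totalCap_gE h0]
      simp [directCap]
      linarith
    · refine ⟨show IsPathOn gE [2, 0] 2 0 by decide, hn₁,
        show IsPathOn gE [0, 3] 0 3 by decide, hn₂,
        show IsPathOn gE [2, 1] 2 1 by decide, hn₃,
        show IsPathOn gE [1, 3] 1 3 by decide, hn₄,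
        feasible_of_split m sz _ hn₄ (fun i => decide (i ∈ A)) ?_ ?_ ?_ ?_⟩ <;>
      simp only [execPath_db, execPath_be, execPath_dc, execPath_ce, shift_02, shift_30,
        shift_12, shift_31] <;>
      linarith [hn 3 0, hn 0 2, hn 3 1, hn 1 2]
end
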